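/- Assume f is both squeeze stationary and squash stationary, let a ∈ U and 0 < r₀ < dist(a, ℝ^m ∖ U), and suppose H_a(ρ) > 0 for every ρ ∈ (0, r₀] and D_a(r₀) > 0. Then for every r ∈ (0, r₀], D_a(r)/r^{m−2} ≤ (r/r₀)^{2N_a(r)}·(D_a(r₀)/r₀^{m−2})·(N_a(r)/N_a(r₀)). -/

import Mathlib

open MeasureTheory Metric
open scoped RealInnerProductSpace ENNReal NNReal Topology
noncomputable section

/-- The separable Hilbert space `ℓ₂` of square-summable real sequences. -/
abbrev ell2 : Type := lp (fun _ : ℕ => ℝ) 2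

/-- Euclidean space `ℝ^m`. -/
abbrev Em (m : ℕ) : Type := EuclideanSpace ℝ (Fin m)

/-- Squared Hilbert–Schmidt norm `‖A‖²_HS = ∑ i ‖A eᵢ‖²` of `A : ℝ^m →L ℓ₂`. -/
def hsNormSq {m : ℕ} (A : Em m →L[ℝ] ell2) : ℝ :=
  ∑ i : Fin m, ‖A (EuclideanSpace.single i 1)‖ ^ 2

/-- Hilbert–Schmidt inner product `⟨A,B⟩ = ∑ i ⟨A eᵢ, B eᵢ⟩`. -/
def hsInner {m : ℕ} (A B : Em m →L[ℝ] ell2) : ℝ :=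
  ∑ i : Fin m, ⟪A (EuclideanSpace.single i 1), B (EuclideanSpace.single i 1)⟫

/-- Divergence `div X = ∑ i ⟨DX(x) eᵢ, eᵢ⟩` of a vector field `X : ℝ^m → ℝ^m`. -/
def divg {m : ℕ} (X : Em m → Em m) (x : Em m) : ℝ :=
  ∑ i : Fin m, ⟪fderiv ℝ X x (EuclideanSpace.single i 1), EuclideanSpace.single i 1⟫

/-- `f` is squeeze stationary on `U`: for every smooth compactly supported vector field
`X` with support in `U`, the inner variation `t ↦ ∫_U ‖D(f ∘ Φ_t)‖²_HS`,
`Φ_t(x) = x + tX(x)`, has derivative `0` at `t = 0`. -/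
def SqueezeStationary {m : ℕ} (U : Set (Em m)) (f : Em m → ell2) : Prop :=
  ∀ X : Em m → Em m, ContDiff ℝ (⊤ : ℕ∞) X → HasCompactSupport X → tsupport X ⊆ U →
    HasDerivAt
      (fun t : ℝ => ∫ x in U, hsNormSq (fderiv ℝ (fun y => f (y + t • X y)) x)) 0 0

/-- `f` is squash stationary on `U`: for every `C¹` map `Y : U × ℓ₂ → ℓ₂` which is
bounded, has bounded derivative, and with `{x : Y(x,·) ≢ 0}` relatively compact in `U`,
the outer variation `t ↦ ∫_U ‖D(f + tY(·, f(·)))‖²_HS` has derivative `0` at `t = 0`. -/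
def SquashStationary {m : ℕ} (U : Set (Em m)) (f : Em m → ell2) : Prop :=
  ∀ Y : Em m × ell2 → ell2, ContDiff ℝ 1 Y →
    (∃ C, ∀ p, ‖Y p‖ ≤ C) → (∃ C, ∀ p, ‖fderiv ℝ Y p‖ ≤ C) →
    IsCompact (closure {x : Em m | ∃ y, Y (x, y) ≠ 0}) →
    closure {x : Em m | ∃ y, Y (x, y) ≠ 0} ⊆ U →
    HasDerivAt
      (fun t : ℝ =>
        ∫ x in U, hsNormSq (fderiv ℝ (fun z => f z + t • Y (z, f z)) x)) 0 0

open scoped Pointwise in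
/-- The volume of a spherical shell over `s` controls the cone measure of `s`. -/
lemma mul_toSphere_le_volume_shell {m : ℕ} {s : Set (sphere (0 : Em m) 1)}
    (hs : MeasurableSet s) {δ : ℝ} (hδ : 0 < δ) :
    ENNReal.ofReal δ * (volume : Measure (Em m)).toSphere s ≤
      volume (Set.Ico (1 : ℝ) (1 + δ) • ((↑) '' s : Set (Em m))) := by
  rw [Measure.toSphere_apply' _ hs]
  set V := volume (Set.Ioo (0 : ℝ) 1 • ((↑) '' s : Set (Em m))) with hV
  have hVfin : V ≠ ∞ := by
    refine ((measure_mono ?_).trans_lt (measure_ball_lt_top (x := (0 : Em m)) (r := 1))).ne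
    rintro _ ⟨c, hc, _, ⟨x, -, rfl⟩, rfl⟩
    simp [norm_smul, abs_of_pos hc.1, hc.2]
  have hscale : volume (Set.Ioo (0 : ℝ) (1 + δ) • ((↑) '' s : Set (Em m))) =
      ENNReal.ofReal ((1 + δ) ^ m) * V := by
    have : Set.Ioo (0 : ℝ) (1 + δ) = (1 + δ) • Set.Ioo (0 : ℝ) 1 := by
      rw [LinearOrderedField.smul_Ioo (by linarith)]; simp
    rw [this, smul_assoc, Measure.addHaar_smul_of_nonneg _ (by linarith)]
    simp [hV]
  have hcover : Set.Ioo (0 : ℝ) (1 + δ) • ((↑) '' s : Set (Em m)) ⊆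
      Set.Ioo (0 : ℝ) 1 • ((↑) '' s : Set (Em m)) ∪
        Set.Ico (1 : ℝ) (1 + δ) • ((↑) '' s : Set (Em m)) := by
    rw [← Set.union_smul]
    refine Set.smul_subset_smul_right fun x hx => ?_
    rcases lt_or_ge x 1 with h | h
    · exact Or.inl ⟨hx.1, h⟩
    · exact Or.inr ⟨h, hx.2⟩
  have h1 := (measure_mono hcover).trans (measure_union_le (μ := volume) _ _)
  rw [hscale, ← hV] at h1
  have hbern : ENNReal.ofReal δ * (m * V) + V ≤ ENNReal.ofReal ((1 + δ) ^ m) * V := by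
    have h2 : 1 + (m : ℝ) * δ ≤ (1 + δ) ^ m := one_add_mul_le_pow (by linarith) m
    calc ENNReal.ofReal δ * (m * V) + V = ENNReal.ofReal (1 + (m : ℝ) * δ) * V := by
          rw [ENNReal.ofReal_add (by norm_num) (by positivity), ENNReal.ofReal_mul (by positivity)]
          simp
          ring
      _ ≤ _ := by gcongr
  have h3 := hbern.trans h1
  rw [add_comm V] at h3
  simpa using (ENNReal.add_le_add_iff_right hVfin).1 h3

open scoped Pointwise in
/-- A shell over a small spherical set has volume bounded through the diameter of the set. -/
lemma volume_shell_le {m : ℕ} {s : Set (sphere (0 : Em m) 1)}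
    {p : sphere (0 : Em m) 1} (hp : p ∈ s) {d δ : ℝ} (hd : 0 ≤ d) (hd1 : d ≤ 1) (hδ : 0 < δ)
    (hs : ∀ x ∈ s, ∀ y ∈ s, dist x y ≤ d) :
    volume (Set.Ico (1 : ℝ) (1 + δ) • ((↑) '' s : Set (Em m))) ≤
      ENNReal.ofReal ((1 + δ) * d) ^ (m - 1) * ENNReal.ofReal (δ + d ^ 2 / 2) := by
  have hp1 : ‖(p : Em m)‖ = 1 := by simp
  have hpos : 0 < m := by
    rcases Nat.eq_zero_or_pos m with rfl | h
    · exfalso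
      have : (p : Em 0) = 0 := Subsingleton.elim _ _
      rw [this] at hp1; simp at hp1
    · exact h
  let i0 : Fin m := ⟨0, hpos⟩
  obtain ⟨b, hb⟩ : ∃ b : OrthonormalBasis (Fin m) ℝ (Em m), b i0 = p := by
    have horth : Orthonormal ℝ (({i0} : Set (Fin m)).domRestrict (fun _ => (p : Em m))) := by
      constructor
      · intro i; exact hp1
      · intro i j hij; exact absurd (Subsingleton.elim i j) hij
    obtain ⟨b, hb⟩ := horth.exists_orthonormalBasis_extension_of_card_eq (by simp)
    exact ⟨b, hb i0 rfl⟩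
  have hbd : ∀ i, ∀ x ∈ s, ∀ y ∈ s, ⟪b i, (x : Em m)⟫ - ⟪b i, (y : Em m)⟫ ≤ d := by
    intro i x hx y hy
    rw [← inner_sub_right]
    refine (real_inner_le_norm _ _).trans ?_
    rw [b.orthonormal.1 i, one_mul, ← dist_eq_norm]
    exact hs x hx y hy
  have hzero : ∀ i, i ≠ i0 → ⟪b i, (p : Em m)⟫ = 0 := fun i hi => by
    rw [← hb]; exact b.orthonormal.2 hi
  let S : Fin m → Set ℝ := fun i => (fun x : sphere (0 : Em m) 1 => ⟪b i, (x : Em m)⟫) '' s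
  have hne : ∀ i, (S i).Nonempty := fun i => ⟨_, p, hp, rfl⟩
  have hab : ∀ i, BddAbove (S i) := fun i => ⟨⟪b i, (p : Em m)⟫ + d, by
    rintro _ ⟨x, hx, rfl⟩; have := hbd i x hx p hp; dsimp only; linarith⟩
  have hbb : ∀ i, BddBelow (S i) := fun i => ⟨⟪b i, (p : Em m)⟫ - d, by
    rintro _ ⟨x, hx, rfl⟩; have := hbd i p hp x hx; dsimp only; linarith⟩
  have hwidth : ∀ i, sSup (S i) - sInf (S i) ≤ d := by
    intro i
    have : sSup (S i) ≤ sInf (S i) + d := by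
      refine csSup_le (hne i) ?_
      rintro _ ⟨x, hx, rfl⟩
      have : ⟪b i, (x : Em m)⟫ - d ≤ sInf (S i) := by
        refine le_csInf (hne i) ?_
        rintro _ ⟨y, hy, rfl⟩
        have := hbd i x hx y hy
        dsimp only; linarith
      dsimp only; linarith
    linarith
  let lo : Fin m → ℝ := fun i => if i = i0 then 1 - d ^ 2 / 2 else (1 + δ) * sInf (S i)
  let hi : Fin m → ℝ := fun i => if i = i0 then 1 + δ else (1 + δ) * sSup (S i)
  have hsub : Set.Ico (1 : ℝ) (1 + δ) • ((↑) '' s : Set (Em m)) ⊆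
      (fun x => (b.repr x).ofLp) ⁻¹' Set.Icc lo hi := by
    rintro _ ⟨c, hc, _, ⟨x, hx, rfl⟩, rfl⟩
    have hx1 : ‖(x : Em m)‖ = 1 := by simp
    have hc0 : 0 < c := by linarith [hc.1]
    suffices h : ∀ i, lo i ≤ c * ⟪b i, (x : Em m)⟫ ∧ c * ⟪b i, (x : Em m)⟫ ≤ hi i by
      constructor
      · intro i; simpa [b.repr_apply_apply, inner_smul_right] using (h i).1
      · intro i; simpa [b.repr_apply_apply, inner_smul_right] using (h i).2
    intro i
    by_cases hi0 : i = i0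
    · subst hi0
      simp only [lo, hi, if_true, hb]
      have h1 : ⟪(p : Em m), (x : Em m)⟫ ≤ 1 := by
        have := real_inner_le_norm (p : Em m) (x : Em m)
        rwa [hp1, hx1, one_mul] at this
      have h2 : 1 - d ^ 2 / 2 ≤ ⟪(p : Em m), (x : Em m)⟫ := by
        have h3 : ‖(p : Em m) - x‖ ≤ d := by rw [← dist_eq_norm]; exact hs p hp x hx
        have h4 := norm_sub_sq_real (p : Em m) (x : Em m)
        rw [hp1, hx1] at h4
        have h5 : ‖(p : Em m) - x‖ ^ 2 ≤ d ^ 2 := by gcongr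
        linarith
      constructor
      · have : (0 : ℝ) ≤ 1 - d ^ 2 / 2 := by nlinarith
        nlinarith [hc.1]
      · nlinarith [hc.1, hc.2]
    · simp only [lo, hi, if_neg hi0]
      have h1 : ⟪b i, (x : Em m)⟫ ≤ sSup (S i) := le_csSup (hab i) ⟨x, hx, rfl⟩
      have h2 : sInf (S i) ≤ ⟪b i, (x : Em m)⟫ := csInf_le (hbb i) ⟨x, hx, rfl⟩
      have h3 : 0 ≤ sSup (S i) := by
        rw [← hzero i hi0]; exact le_csSup (hab i) ⟨p, hp, rfl⟩
      have h4 : sInf (S i) ≤ 0 := by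
        rw [← hzero i hi0]; exact csInf_le (hbb i) ⟨p, hp, rfl⟩
      constructor
      · by_cases h : 0 ≤ ⟪b i, (x : Em m)⟫
        · nlinarith [mul_nonneg hc0.le h, mul_nonneg hδ.le (neg_nonneg.2 h4)]
        · push Not at h
          nlinarith [hc.2]
      · by_cases h : 0 ≤ ⟪b i, (x : Em m)⟫
        · nlinarith [hc.2]
        · push Not at h
          nlinarith [mul_nonneg hδ.le h3]
  refine (measure_mono hsub).trans ?_
  have hmp : MeasurePreserving (fun x => (b.repr x).ofLp) (volume : Measure (Em m)) volume :=
    (EuclideanSpace.volume_preserving_symm_measurableEquiv_toLp (Fin m)).comp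
      b.measurePreserving_repr
  rw [hmp.measure_preimage measurableSet_Icc.nullMeasurableSet, Real.volume_Icc_pi,
    ← Finset.mul_prod_erase _ _ (Finset.mem_univ i0), mul_comm]
  gcongr
  · calc ∏ i ∈ Finset.univ.erase i0, ENNReal.ofReal (hi i - lo i)
        ≤ ∏ i ∈ Finset.univ.erase i0, ENNReal.ofReal ((1 + δ) * d) := by
          refine Finset.prod_le_prod' fun i hi' => ?_
          have hi0 := Finset.ne_of_mem_erase hi'
          simp only [lo, hi, if_neg hi0, ← mul_sub]
          exact ENNReal.ofReal_le_ofReal (by nlinarith [hwidth i])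
      _ = _ := by simp
  · simp only [lo, hi, if_true]
    linarith

/-- The cone measure on the unit sphere is dominated by the Hausdorff measure. -/
lemma toSphere_le_hausdorffMeasure {m : ℕ} (hm : 1 ≤ m) :
    (volume : Measure (Em m)).toSphere ≤ μH[(m : ℝ) - 1] := by
  have key : ∀ δ : ℝ, 0 < δ → δ ≤ 1 →
      (ENNReal.ofReal ((1 + δ) ^ m))⁻¹ • (volume : Measure (Em m)).toSphere ≤
        μH[(m : ℝ) - 1] := by
    intro δ hδ hδ1
    refine Measure.le_hausdorffMeasure _ _ (ENNReal.ofReal δ) (by simpa using hδ) fun s hs => ?_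
    rcases s.eq_empty_or_nonempty with rfl | ⟨p, hp⟩
    · simp
    have hne : ediam s ≠ ∞ := (hs.trans_lt ENNReal.ofReal_lt_top).ne
    set d := (ediam s).toReal with hd
    have hd0 : 0 ≤ d := ENNReal.toReal_nonneg
    have hdδ : d ≤ δ := ENNReal.toReal_le_of_le_ofReal hδ.le hs
    have hdist : ∀ x ∈ closure s, ∀ y ∈ closure s, dist x y ≤ d := by
      intro x hx y hy
      rw [dist_edist]
      refine ENNReal.toReal_mono hne ?_
      rw [← ediam_closure]
      exact edist_le_ediam_of_mem hx hy
    have h1 := (mul_toSphere_le_volume_shell (isClosed_closure (s := s)).measurableSet hδ).trans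
      (volume_shell_le (subset_closure hp) hd0 (hdδ.trans hδ1) hδ hdist)
    have h2 : ENNReal.ofReal ((1 + δ) * d) ^ (m - 1) * ENNReal.ofReal (δ + d ^ 2 / 2) ≤
        ENNReal.ofReal δ * (ENNReal.ofReal ((1 + δ) ^ m) * ENNReal.ofReal d ^ (m - 1)) := by
      rw [← ENNReal.ofReal_pow (by positivity), ← ENNReal.ofReal_mul (by positivity),
        ← ENNReal.ofReal_pow (by positivity), ← ENNReal.ofReal_mul (by positivity),
        ← ENNReal.ofReal_mul (by positivity)]
      refine ENNReal.ofReal_le_ofReal ?_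
      have h3 : δ + d ^ 2 / 2 ≤ δ * (1 + δ) := by nlinarith
      calc ((1 + δ) * d) ^ (m - 1) * (δ + d ^ 2 / 2)
          ≤ ((1 + δ) * d) ^ (m - 1) * (δ * (1 + δ)) := by gcongr
        _ = δ * ((1 + δ) ^ (m - 1 + 1) * d ^ (m - 1)) := by rw [mul_pow, pow_succ]; ring
        _ = _ := by rw [Nat.sub_add_cancel hm]
    have h4 := (ENNReal.mul_le_mul_iff_right (by simpa using hδ) ENNReal.ofReal_ne_top).1
      (h1.trans h2)
    rw [Measure.smul_apply, smul_eq_mul]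
    have hpow : ediam s ^ ((m : ℝ) - 1) = ENNReal.ofReal d ^ (m - 1) := by
      rw [hd, ENNReal.ofReal_toReal hne, ← ENNReal.rpow_natCast, Nat.cast_sub hm, Nat.cast_one]
    rw [hpow, mul_comm, ← div_eq_mul_inv]
    refine ENNReal.div_le_of_le_mul' ?_
    exact (measure_mono subset_closure).trans h4
  refine Measure.le_iff.2 fun s _ => ?_
  have hle : ∀ δ : ℝ, 0 < δ → δ ≤ 1 → (volume : Measure (Em m)).toSphere s ≤
      ENNReal.ofReal ((1 + δ) ^ m) * μH[(m : ℝ) - 1] s := by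
    intro δ hδ hδ1
    have h := key δ hδ hδ1 s
    rw [Measure.smul_apply, smul_eq_mul, mul_comm, ← div_eq_mul_inv,
      ENNReal.div_le_iff_le_mul (Or.inl (by positivity)) (Or.inl ENNReal.ofReal_ne_top)] at h
    rwa [mul_comm]
  rcases eq_or_ne (μH[(m : ℝ) - 1] s) ∞ with htop | htop
  · simp [htop]
  have hlim : Filter.Tendsto (fun δ : ℝ => ENNReal.ofReal ((1 + δ) ^ m) * μH[(m : ℝ) - 1] s)
      (𝓝[>] 0) (𝓝 (1 * μH[(m : ℝ) - 1] s)) := by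
    refine ENNReal.Tendsto.mul_const ?_ (Or.inr htop)
    have : Continuous fun δ : ℝ => ENNReal.ofReal ((1 + δ) ^ m) :=
      ENNReal.continuous_ofReal.comp (by fun_prop)
    simpa using (this.tendsto 0).mono_left nhdsWithin_le_nhds
  rw [one_mul] at hlim
  refine ge_of_tendsto hlim ?_
  filter_upwards [Ioc_mem_nhdsGT (zero_lt_one' ℝ)] with δ hδ
  exact hle δ hδ.1 hδ.2

/-- Rotations act transitively on the unit sphere. -/
lemma exists_linearIsometryEquiv_sphere {m : ℕ} (x y : sphere (0 : Em m) 1) :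
    ∃ L : Em m ≃ₗᵢ[ℝ] Em m, L x = y :=
  ⟨_, Submodule.reflection_sub (v := (x : Em m)) (w := y) (by simp)⟩

lemma image_ball_sphere {m : ℕ} {x y : sphere (0 : Em m) 1} (L : Em m ≃ₗᵢ[ℝ] Em m)
    (hL : L x = y) (r : ℝ) :
    L '' ((↑) '' ball x r : Set (Em m)) = ((↑) '' ball y r : Set (Em m)) := by
  simp only [Subtype.image_ball]
  ext z
  constructor
  · rintro ⟨w, ⟨hw, hw'⟩, rfl⟩
    refine ⟨?_, by simpa using hw'⟩
    rw [← hL]; simpa [L.dist_map] using hw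
  · rintro ⟨hz, hz'⟩
    refine ⟨L.symm z, ⟨?_, by simpa using hz'⟩, by simp⟩
    rw [mem_ball, ← L.dist_map, hL]; simpa using hz

open scoped Pointwise in
lemma toSphere_ball_eq {m : ℕ} (x y : sphere (0 : Em m) 1) (r : ℝ) :
    (volume : Measure (Em m)).toSphere (ball x r) =
      (volume : Measure (Em m)).toSphere (ball y r) := by
  obtain ⟨L, hL⟩ := exists_linearIsometryEquiv_sphere x y
  rw [Measure.toSphere_apply' _ measurableSet_ball, Measure.toSphere_apply' _ measurableSet_ball,
    ← image_ball_sphere L hL r]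
  congr 1
  have : Set.Ioo (0 : ℝ) 1 • (L '' ((↑) '' ball x r : Set (Em m))) =
      L '' (Set.Ioo (0 : ℝ) 1 • ((↑) '' ball x r : Set (Em m))) := by
    ext z
    constructor
    · rintro ⟨c, hc, _, ⟨w, hw, rfl⟩, rfl⟩
      exact ⟨c • w, ⟨c, hc, w, hw, rfl⟩, by simp⟩
    · rintro ⟨_, ⟨c, hc, w, hw, rfl⟩, rfl⟩
      exact ⟨c, hc, _, ⟨w, hw, rfl⟩, by simp⟩
  rw [this]
  have h := (show MeasurePreserving L.toMeasurableEquiv volume volume from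
    L.measurePreserving).measure_preimage_equiv
      (L '' (Set.Ioo (0 : ℝ) 1 • ((↑) '' ball x r : Set (Em m))))
  rw [← h]
  congr 1
  exact (Set.preimage_image_eq _ L.injective).symm

lemma hausdorffMeasure_sphere_ball_eq {m : ℕ} {d : ℝ} (hd : 0 ≤ d)
    (x y : sphere (0 : Em m) 1) (r : ℝ) : μH[d] (ball x r) = μH[d] (ball y r) := by
  obtain ⟨L, hL⟩ := exists_linearIsometryEquiv_sphere x y
  rw [← isometry_subtype_coe.hausdorffMeasure_image (Or.inl hd),
    ← isometry_subtype_coe.hausdorffMeasure_image (Or.inl hd) (ball y r),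
    ← image_ball_sphere L hL r, L.isometry.hausdorffMeasure_image (Or.inl hd)]

/-- Two finite uniformly distributed measures on a compact metric space are proportional. -/
lemma integral_mul_measure_univ_eq {X : Type*} [MetricSpace X] [CompactSpace X]
    [MeasurableSpace X] [BorelSpace X] (μ ν : Measure X) [IsFiniteMeasure μ] [IsFiniteMeasure ν]
    (hμ : ∀ x y r, μ (ball x r) = μ (ball y r)) (hν : ∀ x y r, ν (ball x r) = ν (ball y r))
    (hpos : ∀ x r, 0 < r → 0 < ν.real (ball x r)) {g : X → ℝ} (hg : Continuous g) :
    ν.real Set.univ * ∫ x, g x ∂μ = μ.real Set.univ * ∫ x, g x ∂ν := by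
  rcases isEmpty_or_nonempty X with hX | ⟨⟨x₀⟩⟩
  · simp [Set.univ_eq_empty_iff.2 hX]
  have hfubini : ∀ r : ℝ, ∀ h : X → ℝ, Continuous h →
      Integrable (fun x => ∫ y in ball x r, h y ∂ν) μ ∧
      ∫ x, ∫ y in ball x r, h y ∂ν ∂μ = μ.real (ball x₀ r) * ∫ y, h y ∂ν := by
    intro r h hh
    have hmeas : MeasurableSet {p : X × X | dist p.2 p.1 < r} :=
      (isOpen_lt (by fun_prop) (by fun_prop)).measurableSet
    obtain ⟨C, hC⟩ : ∃ C, ∀ x, ‖h x‖ ≤ C := by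
      obtain ⟨C, hC⟩ := isCompact_univ.exists_bound_of_continuousOn hh.continuousOn
      exact ⟨C, fun x => hC x (Set.mem_univ x)⟩
    have hint : Integrable (Function.uncurry fun x y => (ball x r).indicator h y) (μ.prod ν) := by
      have : (Function.uncurry fun x y => (ball x r).indicator h y) =
          {p : X × X | dist p.2 p.1 < r}.indicator (fun p => h p.2) := by
        ext ⟨x, y⟩; simp [Set.indicator]
      rw [this]
      refine Integrable.indicator ?_ hmeas
      exact Integrable.of_bound (hh.comp continuous_snd).aestronglyMeasurable C
        (Filter.Eventually.of_forall fun p => hC p.2)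
    refine ⟨by simpa [integral_indicator measurableSet_ball] using hint.integral_prod_left, ?_⟩
    calc ∫ x, ∫ y in ball x r, h y ∂ν ∂μ
        = ∫ x, ∫ y, (ball x r).indicator h y ∂ν ∂μ := by
          simp_rw [integral_indicator measurableSet_ball]
      _ = ∫ y, ∫ x, (ball x r).indicator h y ∂μ ∂ν := integral_integral_swap hint
      _ = ∫ y, μ.real (ball x₀ r) * h y ∂ν := by
          congr 1; ext y
          have : (fun x => (ball x r).indicator h y) =
              (ball y r).indicator fun _ => h y := by
            ext x; simp [Set.indicator, dist_comm]
          rw [this, integral_indicator measurableSet_ball, setIntegral_const, smul_eq_mul,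
            measureReal_def, measureReal_def, hμ y x₀]
      _ = _ := integral_const_mul _ _
  have hkr : ∀ r x, ν.real (ball x r) = ν.real (ball x₀ r) := fun r x => by
    rw [measureReal_def, measureReal_def, hν x x₀]
  have happrox : ∀ ε > 0, |ν.real Set.univ * ∫ x, g x ∂μ - μ.real Set.univ * ∫ x, g x ∂ν| ≤
      ε * (ν.real Set.univ * μ.real Set.univ) := by
    intro ε hε
    obtain ⟨r, hr, hgr⟩ := Metric.uniformContinuous_iff.1
      (CompactSpace.uniformContinuous_of_continuous hg) ε hε
    set k := ν.real (ball x₀ r) with hk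
    have hk0 : 0 < k := hpos x₀ r hr
    have h1 := (hfubini r (fun _ => 1) continuous_const).2
    simp only [integral_const, measureReal_restrict_apply_univ, smul_eq_mul, mul_one, hkr,
      ← hk] at h1
    obtain ⟨hint, h2⟩ := hfubini r g hg
    have hgi : Integrable g ν := hg.integrable_of_hasCompactSupport
      (HasCompactSupport.of_compactSpace g)
    have hgi' : Integrable g μ := hg.integrable_of_hasCompactSupport
      (HasCompactSupport.of_compactSpace g)
    have hloc : ∀ x, ‖k * g x - ∫ y in ball x r, g y ∂ν‖ ≤ ε * k := by
      intro x
      have : k * g x - ∫ y in ball x r, g y ∂ν = ∫ y in ball x r, (g x - g y) ∂ν := by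
        rw [integral_sub (integrable_const _) hgi.integrableOn, setIntegral_const, smul_eq_mul,
          hkr r x]
      rw [this, hk, ← hkr r x]
      refine norm_setIntegral_le_of_norm_le_const (measure_lt_top _ _) fun y hy => ?_
      rw [← dist_eq_norm]
      exact (hgr (by rw [dist_comm]; exact hy)).le
    have h3 : |k * ∫ x, g x ∂μ - μ.real (ball x₀ r) * ∫ y, g y ∂ν| ≤ ε * k * μ.real Set.univ := by
      rw [← h2, ← integral_const_mul, ← integral_sub (hgi'.const_mul k) hint]
      exact norm_integral_le_of_norm_le_const (Filter.Eventually.of_forall hloc)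
    have h4 : k * (ν.real Set.univ * ∫ x, g x ∂μ - μ.real Set.univ * ∫ x, g x ∂ν) =
        ν.real Set.univ * (k * ∫ x, g x ∂μ - μ.real (ball x₀ r) * ∫ y, g y ∂ν) := by
      linear_combination (-∫ x, g x ∂ν) * h1
    have h5 : k * |ν.real Set.univ * ∫ x, g x ∂μ - μ.real Set.univ * ∫ x, g x ∂ν| ≤
        k * (ε * (ν.real Set.univ * μ.real Set.univ)) := by
      rw [← abs_of_pos hk0, ← abs_mul, h4, abs_mul, abs_of_pos hk0,
        abs_of_nonneg (measureReal_nonneg (μ := ν))]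
      calc _ ≤ ν.real Set.univ * (ε * k * μ.real Set.univ) := by gcongr
        _ = _ := by ring
    exact le_of_mul_le_mul_left h5 hk0
  have hzero : |ν.real Set.univ * ∫ x, g x ∂μ - μ.real Set.univ * ∫ x, g x ∂ν| ≤ 0 := by
    refine le_of_forall_pos_le_add fun ε hε => ?_
    set c := ν.real Set.univ * μ.real Set.univ
    have hc : 0 ≤ c := by positivity
    refine (happrox (ε / (c + 1)) (by positivity)).trans ?_
    rw [div_mul_eq_mul_div, div_le_iff₀ (by positivity)]
    nlinarith
  exact sub_eq_zero.1 (abs_nonpos_iff.1 hzero)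

/-- The integral over a sphere with respect to the Hausdorff measure, rescaled to the unit
sphere. -/
lemma setIntegral_sphere_hausdorffMeasure {m : ℕ} (hm : 1 ≤ m) (a : Em m) {ρ : ℝ} (hρ : 0 < ρ)
    (g : Em m → ℝ) :
    ∫ x in sphere a ρ, g x ∂(μH[(m : ℝ) - 1]) =
      ρ ^ (m - 1) * ∫ ω : sphere (0 : Em m) 1, g (a + ρ • (ω : Em m)) ∂(μH[(m : ℝ) - 1]) := by
  have hd : (0 : ℝ) ≤ (m : ℝ) - 1 := by
    have : (1 : ℝ) ≤ m := by exact_mod_cast hm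
    linarith
  set d := (m : ℝ) - 1 with hd'
  let j : sphere (0 : Em m) 1 → Em m := fun ω => a + ρ • (ω : Em m)
  have hj : MeasurableEmbedding j := by
    refine Continuous.measurableEmbedding (by fun_prop) fun x y hxy => ?_
    have : ρ • (x : Em m) = ρ • (y : Em m) := add_left_cancel hxy
    exact Subtype.ext (smul_right_injective _ hρ.ne' this)
  have hrange : ∀ t : Set (Em m), t ∩ sphere a ρ = j '' (j ⁻¹' t) := by
    intro t
    rw [Set.image_preimage_eq_inter_range]
    congr 1
    ext x
    constructor
    · intro hx
      refine ⟨⟨ρ⁻¹ • (x - a), ?_⟩, ?_⟩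
      · rw [mem_sphere, dist_eq_norm] at hx
        simp [norm_smul, hx, abs_of_pos hρ, hρ.ne']
      · simp [j, smul_smul, hρ.ne']
    · rintro ⟨ω, rfl⟩
      simp [j, norm_smul, abs_of_pos hρ]
  have himage : ∀ s : Set (sphere (0 : Em m) 1),
      μH[d] (j '' s) = ENNReal.ofReal (ρ ^ (m - 1)) * μH[d] s := by
    intro s
    have h1 : j '' s = (IsometryEquiv.addLeft a) '' ((fun x : Em m => ρ • x) '' ((↑) '' s)) := by
      simp only [Set.image_image]; rfl
    rw [h1, IsometryEquiv.hausdorffMeasure_image, Set.image_smul,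
      Measure.hausdorffMeasure_smul₀ hd hρ.ne', isometry_subtype_coe.hausdorffMeasure_image
        (Or.inl hd), ENNReal.smul_def, smul_eq_mul]
    congr 1
    rw [ENNReal.coe_rpow_of_nonneg _ hd, hd', ← Nat.cast_one, ← Nat.cast_sub hm,
      ENNReal.rpow_natCast, ENNReal.ofReal_pow hρ.le, ← enorm_eq_nnnorm,
      Real.enorm_eq_ofReal hρ.le]
  have hmap : (μH[d] : Measure (Em m)).restrict (sphere a ρ) =
      ENNReal.ofReal (ρ ^ (m - 1)) • (μH[d] : Measure (sphere (0 : Em m) 1)).map j := by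
    ext t ht
    rw [Measure.restrict_apply ht, hrange, himage, Measure.smul_apply, hj.map_apply, smul_eq_mul]
  rw [hmap, integral_smul_measure, hj.integral_map, ENNReal.toReal_ofReal (by positivity),
    smul_eq_mul]

/-- A uniformly distributed measure on a compact space with a continuous function of nonzero
integral is finite. -/
lemma isFiniteMeasure_of_integral_ne_zero {X : Type*} [MetricSpace X] [CompactSpace X]
    [MeasurableSpace X] [BorelSpace X] (μ : Measure X)
    (hμ : ∀ x y r, μ (ball x r) = μ (ball y r)) {g : X → ℝ} (hg : Continuous g)
    (hne : ∫ x, g x ∂μ ≠ 0) : IsFiniteMeasure μ := by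
  have hint : Integrable g μ := by
    by_contra h
    exact hne (integral_undef h)
  obtain ⟨x, hx⟩ : ∃ x, g x ≠ 0 := by
    by_contra! h
    exact hne (by simp [h])
  have hopen : IsOpen {y | ‖g x‖ / 2 < ‖g y‖} := isOpen_lt continuous_const hg.norm
  have hgx : 0 < ‖g x‖ := norm_pos_iff.2 hx
  obtain ⟨r, hr, hsub⟩ := Metric.isOpen_iff.1 hopen x (by simpa using hgx)
  have hfin : μ (ball x r) < ∞ :=
    (measure_mono fun y hy => show ‖g x‖ / 2 ≤ ‖g y‖ from (hsub hy).le).trans_lt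
      (hint.measure_norm_ge_lt_top (half_pos hgx))
  have : IsLocallyFiniteMeasure μ :=
    ⟨fun y => ⟨ball y r, ball_mem_nhds y hr, by rwa [hμ y x]⟩⟩
  infer_instance

/-- On a family of spheres, Hausdorff integrals are a constant multiple, at least one, of the
polar-coordinate integrals. -/
lemma exists_const_setIntegral_sphere {m : ℕ} (hm : 1 ≤ m) (a : Em m) {r₀ : ℝ} (hr₀ : 0 < r₀)
    {g : Em m → ℝ} (hg : ContinuousOn g (closedBall a r₀))
    (hne : ∫ x in sphere a r₀, g x ∂(μH[(m : ℝ) - 1]) ≠ 0) :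
    ∃ C : ℝ, 1 ≤ C ∧ ∀ ρ ∈ Set.Ioc 0 r₀, ∫ x in sphere a ρ, g x ∂(μH[(m : ℝ) - 1]) =
      C * (ρ ^ (m - 1) *
        ∫ ω, g (a + ρ • (ω : Em m)) ∂((volume : Measure (Em m)).toSphere)) := by
  have hd : (0 : ℝ) ≤ (m : ℝ) - 1 := by
    have : (1 : ℝ) ≤ m := by exact_mod_cast hm
    linarith
  have hcont : ∀ ρ ∈ Set.Ioc 0 r₀,
      Continuous fun ω : sphere (0 : Em m) 1 => g (a + ρ • (ω : Em m)) := by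
    intro ρ hρ
    refine hg.comp_continuous (by fun_prop) fun ω => ?_
    simp [norm_smul, abs_of_pos hρ.1, hρ.2]
  have hballs := hausdorffMeasure_sphere_ball_eq (m := m) hd
  have hfin : IsFiniteMeasure (μH[(m : ℝ) - 1] : Measure (sphere (0 : Em m) 1)) := by
    refine isFiniteMeasure_of_integral_ne_zero _ hballs (hcont r₀ ⟨hr₀, le_rfl⟩) fun h => hne ?_
    rw [setIntegral_sphere_hausdorffMeasure hm a hr₀, h, mul_zero]
  set σ := (volume : Measure (Em m)).toSphere with hσ
  have hσpos : 0 < σ.real Set.univ := by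
    have : Nonempty (Fin m) := ⟨⟨0, hm⟩⟩
    have h0 : σ ≠ 0 := Measure.toSphere_ne_zero _
    have : NeZero σ := ⟨h0⟩
    exact measureReal_univ_pos
  refine ⟨(μH[(m : ℝ) - 1] : Measure (sphere (0 : Em m) 1)).real Set.univ / σ.real Set.univ,
    ?_, fun ρ hρ => ?_⟩
  · rw [one_le_div hσpos]
    exact ENNReal.toReal_mono (measure_ne_top _ _) (toSphere_le_hausdorffMeasure hm _)
  · have h := integral_mul_measure_univ_eq (μH[(m : ℝ) - 1]) σ hballs toSphere_ball_eq
      (fun x r hr => ENNReal.toReal_pos (isOpen_ball.measure_pos _ ⟨x, mem_ball_self hr⟩).ne'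
        (measure_ne_top _ _)) (hcont ρ hρ)
    rw [setIntegral_sphere_hausdorffMeasure hm a hρ.1]
    field_simp
    linear_combination ρ ^ (m - 1) * h

/-- Polar coordinates in `ℝ^m`. -/
lemma integral_eq_integral_Ioi_sphere {m : ℕ} (hm : 1 ≤ m) {G : Em m → ℝ} (hG : Integrable G) :
    ∫ x, G x = ∫ ρ in Set.Ioi (0 : ℝ), ρ ^ (m - 1) *
      ∫ ω, G (ρ • (ω : Em m)) ∂((volume : Measure (Em m)).toSphere) := by
  set σ := (volume : Measure (Em m)).toSphere with hσ
  have : Nonempty (Fin m) := ⟨⟨0, hm⟩⟩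
  have hmp := (volume : Measure (Em m)).measurePreserving_homeomorphUnitSphereProd
  have hemb := (homeomorphUnitSphereProd (Em m)).measurableEmbedding
  have hdim : Module.finrank ℝ (Em m) = m := by simp
  rw [hdim] at hmp
  let K : sphere (0 : Em m) 1 × Set.Ioi (0 : ℝ) → ℝ := fun p => G (p.2.1 • (p.1 : Em m))
  have hK : ∀ x : ({0}ᶜ : Set (Em m)), K (homeomorphUnitSphereProd (Em m) x) = G x := by
    intro x
    have : ‖(x : Em m)‖ ≠ 0 := norm_ne_zero_iff.2 x.2
    simp [K, smul_smul, this]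
  have hKint : Integrable K (σ.prod (.volumeIoiPow (m - 1))) := by
    rw [← hmp.integrable_comp_emb hemb]
    have h1 : K ∘ homeomorphUnitSphereProd (Em m) = G ∘ (↑) := funext hK
    rw [h1, ← integrableOn_iff_comap_subtypeVal (measurableSet_singleton _).compl]
    exact hG.integrableOn
  calc ∫ x, G x = ∫ x : ({0}ᶜ : Set (Em m)), G x ∂((volume : Measure (Em m)).comap (↑)) := by
        rw [integral_subtype_comap (measurableSet_singleton _).compl G,
          restrict_compl_singleton]
    _ = ∫ p, K p ∂(σ.prod (.volumeIoiPow (m - 1))) := by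
        rw [← hmp.integral_comp hemb]
        simp_rw [hK]
    _ = ∫ ρ : Set.Ioi (0 : ℝ), ∫ ω, K (ω, ρ) ∂σ ∂(.volumeIoiPow (m - 1)) :=
        integral_prod_symm _ hKint
    _ = _ := by
        simp only [Measure.volumeIoiPow, ENNReal.ofReal]
        rw [integral_withDensity_eq_integral_smul
            ((measurable_subtype_coe.pow_const _).real_toNNReal),
          integral_subtype_comap measurableSet_Ioi fun ρ : ℝ => Real.toNNReal (ρ ^ (m - 1)) •
            ∫ ω, G (ρ • (ω : Em m)) ∂σ]
        refine setIntegral_congr_fun measurableSet_Ioi fun ρ hρ => ?_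
        rw [NNReal.smul_def, Real.coe_toNNReal _ (pow_nonneg (Set.mem_Ioi.1 hρ).le _), smul_eq_mul]

/-- Polar coordinates in a ball. -/
lemma setIntegral_ball_eq_intervalIntegral {m : ℕ} (hm : 1 ≤ m) (a : Em m) {r : ℝ} (hr : 0 ≤ r)
    {g : Em m → ℝ} (hg : IntegrableOn g (ball a r)) :
    ∫ x in ball a r, g x = ∫ ρ in (0 : ℝ)..r, ρ ^ (m - 1) *
      ∫ ω, g (a + ρ • (ω : Em m)) ∂((volume : Measure (Em m)).toSphere) := by
  have hint : Integrable ((ball a r).indicator g) :=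
    (integrable_indicator_iff measurableSet_ball).2 hg
  rw [← integral_indicator measurableSet_ball, ← integral_add_left_eq_self _ a,
    integral_eq_integral_Ioi_sphere hm (hint.comp_add_left a), intervalIntegral.integral_of_le hr,
    integral_Ioc_eq_integral_Ioo]
  have hsub : Set.Ioo 0 r ⊆ Set.Ioi (0 : ℝ) := fun x hx => hx.1
  rw [← Set.inter_eq_self_of_subset_right hsub, ← setIntegral_indicator measurableSet_Ioo]
  refine setIntegral_congr_fun measurableSet_Ioi fun ρ hρ => ?_
  have hρ0 : 0 < ρ := hρ
  by_cases h : ρ < r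
  · simp [Set.indicator, hρ0, h, norm_smul, abs_of_pos hρ0]
  · simp [Set.indicator, h, norm_smul, abs_of_pos hρ0]

/-- Continuity of the radial integrals of a function on a ball. -/
lemma continuousOn_integral_sphere {X : Type*} [TopologicalSpace X] [CompactSpace X]
    [MeasurableSpace X] [OpensMeasurableSpace X] {μ : Measure X} [IsFiniteMeasure μ]
    {R : ℝ} (hR : 0 ≤ R)
    {K : ℝ → X → ℝ} (hK : ContinuousOn (Function.uncurry K) (Set.Icc 0 R ×ˢ Set.univ)) :
    ContinuousOn (fun ρ => ∫ ω, K ρ ω ∂μ) (Set.Icc 0 R) := by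
  have hext : Continuous fun p : ℝ × X => K (Set.projIcc 0 R hR p.1) p.2 :=
    hK.comp_continuous (f := fun p : ℝ × X => ((Set.projIcc 0 R hR p.1 : ℝ), p.2))
      (by fun_prop) fun p => ⟨(Set.projIcc 0 R hR p.1).2, trivial⟩
  have h1 : Continuous fun ρ => ∫ ω in Set.univ, K (Set.projIcc 0 R hR ρ) ω ∂μ :=
    continuous_parametric_integral_of_continuous hext isCompact_univ
  refine h1.continuousOn.congr fun ρ hρ => ?_
  simp [Set.projIcc_of_mem hR hρ]

/-- Smooth radial cut-offs, as functions of the squared radius, vanishing near `R`. -/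
structure IsRadialCutoff (R : ℝ) (θ : ℝ → ℝ) : Prop where
  contDiff : ContDiff ℝ (⊤ : ℕ∞) θ
  nonneg : ∀ s, 0 ≤ θ s
  le_one : ∀ s, θ s ≤ 1
  vanish : ∃ r₁, 0 < r₁ ∧ r₁ < R ∧ ∀ s, r₁ ^ 2 ≤ s → θ s = 0

namespace IsRadialCutoff

variable {R : ℝ} {θ : ℝ → ℝ}

lemma hasDerivAt (hθ : IsRadialCutoff R θ) (s : ℝ) : HasDerivAt θ (deriv θ s) s :=
  (hθ.contDiff.differentiable (by simp) s).hasDerivAt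

lemma continuous_deriv (hθ : IsRadialCutoff R θ) : Continuous (deriv θ) :=
  hθ.contDiff.continuous_deriv (by simp)

lemma hasDerivAt_comp_sq (hθ : IsRadialCutoff R θ) (ρ : ℝ) :
    HasDerivAt (fun ρ => θ (ρ ^ 2)) (2 * ρ * deriv θ (ρ ^ 2)) ρ := by
  have h := (hθ.hasDerivAt (ρ ^ 2)).comp ρ (hasDerivAt_pow 2 ρ)
  refine h.congr_deriv ?_
  push_cast
  ring

lemma apply_radius_sq (hθ : IsRadialCutoff R θ) : θ (R ^ 2) = 0 := by
  obtain ⟨r₁, h0, h1, h2⟩ := hθ.vanish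
  exact h2 _ (by gcongr)

end IsRadialCutoff

/-- The fundamental lemma of the calculus of variations for radial cut-offs. -/
lemma nonpos_of_forall_isRadialCutoff {R : ℝ} {w : ℝ → ℝ} (hw : Continuous w)
    (h : ∀ θ, IsRadialCutoff R θ → ∫ ρ in (0 : ℝ)..R, 2 * ρ * deriv θ (ρ ^ 2) * w ρ = 0)
    {r : ℝ} (hr : 0 < r) (hrR : r < R) : w r ≤ 0 := by
  by_contra! hpos
  set c := w r / 2 with hc
  have hc0 : 0 < c := half_pos hpos
  obtain ⟨r₁, hr₁, hr₁R, hwc⟩ : ∃ r₁, r < r₁ ∧ r₁ < R ∧ ∀ ρ ∈ Set.Icc r r₁, c ≤ w ρ := by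
    have hev : ∀ᶠ ρ in 𝓝 r, c < w ρ := hw.continuousAt.eventually (lt_mem_nhds (by linarith))
    obtain ⟨δ, hδ, hball⟩ := Metric.eventually_nhds_iff.1 hev
    refine ⟨r + min (δ / 2) ((R - r) / 2), ?_, ?_, fun ρ hρ => (hball ?_).le⟩
    · have : 0 < min (δ / 2) ((R - r) / 2) := lt_min (by linarith) (by linarith)
      linarith
    · have := min_le_right (δ / 2) ((R - r) / 2)
      linarith
    · have := min_le_left (δ / 2) ((R - r) / 2)
      rw [Real.dist_eq, abs_of_nonneg (by linarith [hρ.1])]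
      linarith [hρ.2]
  have hgap : 0 < r₁ ^ 2 - r ^ 2 := by nlinarith
  let θ : ℝ → ℝ := fun s => Real.smoothTransition ((r₁ ^ 2 - s) / (r₁ ^ 2 - r ^ 2))
  have hθzero : ∀ s, r₁ ^ 2 ≤ s → θ s = 0 := fun s hs =>
    Real.smoothTransition.zero_of_nonpos (div_nonpos_of_nonpos_of_nonneg (by linarith) hgap.le)
  have hθone : ∀ s, s ≤ r ^ 2 → θ s = 1 := fun s hs =>
    Real.smoothTransition.one_of_one_le ((one_le_div hgap).2 (by linarith))
  have hθ : IsRadialCutoff R θ :=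
    { contDiff := Real.smoothTransition.contDiff.comp (by fun_prop)
      nonneg := fun s => Real.smoothTransition.nonneg _
      le_one := fun s => Real.smoothTransition.le_one _
      vanish := ⟨r₁, hr.trans hr₁, hr₁R, hθzero⟩ }
  have hanti : Antitone θ := fun s t hst =>
    Real.smoothTransition.monotone (div_le_div_of_nonneg_right (by linarith) hgap.le)
  have hderiv_nonpos : ∀ s, deriv θ s ≤ 0 := fun s => hanti.deriv_nonpos
  have hd0 : ∀ ρ, 0 ≤ ρ → ρ ∉ Set.Icc r r₁ → deriv θ (ρ ^ 2) = 0 := by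
    intro ρ hρ hnot
    rcases lt_or_ge ρ r with h1 | h1
    · have : θ =ᶠ[𝓝 (ρ ^ 2)] fun _ => 1 := by
        filter_upwards [gt_mem_nhds (show ρ ^ 2 < r ^ 2 by gcongr)] with s hs
        exact hθone s hs.le
      rw [this.deriv_eq]; simp
    · have h2 : r₁ < ρ := by
        by_contra! h3
        exact hnot ⟨h1, h3⟩
      have : θ =ᶠ[𝓝 (ρ ^ 2)] fun _ => 0 := by
        filter_upwards [lt_mem_nhds (show r₁ ^ 2 < ρ ^ 2 by
          have := hr.trans hr₁; gcongr)] with s hs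
        exact hθzero s hs.le
      rw [this.deriv_eq]; simp
  have hcont : Continuous fun ρ : ℝ => 2 * ρ * deriv θ (ρ ^ 2) := by
    have := hθ.continuous_deriv
    fun_prop
  have htotal : ∫ ρ in (0 : ℝ)..R, 2 * ρ * deriv θ (ρ ^ 2) * c = -c := by
    rw [intervalIntegral.integral_mul_const, intervalIntegral.integral_eq_sub_of_hasDerivAt
      (fun ρ _ => hθ.hasDerivAt_comp_sq ρ) (hcont.intervalIntegrable _ _), hθ.apply_radius_sq,
      hθone _ (by simpa using sq_nonneg r)]
    ring
  have hmono : ∫ ρ in (0 : ℝ)..R, 2 * ρ * deriv θ (ρ ^ 2) * w ρ ≤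
      ∫ ρ in (0 : ℝ)..R, 2 * ρ * deriv θ (ρ ^ 2) * c := by
    refine intervalIntegral.integral_mono_on (hr.trans hrR).le
      ((hcont.mul hw).intervalIntegrable _ _)
      ((hcont.mul continuous_const).intervalIntegrable _ _) fun ρ hρ => ?_
    by_cases hmem : ρ ∈ Set.Icc r r₁
    · exact mul_le_mul_of_nonpos_left (hwc ρ hmem)
        (mul_nonpos_of_nonneg_of_nonpos (by linarith [hρ.1]) (hderiv_nonpos _))
    · simp [hd0 ρ hρ.1 hmem]
  rw [h θ hθ, htotal] at hmono
  linarith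

lemma eq_zero_of_forall_isRadialCutoff {R : ℝ} {w : ℝ → ℝ} (hw : Continuous w)
    (h : ∀ θ, IsRadialCutoff R θ → ∫ ρ in (0 : ℝ)..R, 2 * ρ * deriv θ (ρ ^ 2) * w ρ = 0)
    {r : ℝ} (hr : 0 < r) (hrR : r < R) : w r = 0 := by
  refine le_antisymm (nonpos_of_forall_isRadialCutoff hw h hr hrR) ?_
  have := nonpos_of_forall_isRadialCutoff (w := fun ρ => -w ρ) hw.neg (R := R) (fun θ hθ => by
    simp only [mul_neg, intervalIntegral.integral_neg, h θ hθ, neg_zero]) hr hrR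
  linarith

/-- Integration by parts against a radial cut-off. -/
lemma integral_cutoff_mul_eq {R : ℝ} {θ : ℝ → ℝ} (hθ : IsRadialCutoff R θ)
    {u : ℝ → ℝ} (hu : Continuous u) :
    ∫ ρ in (0 : ℝ)..R, θ (ρ ^ 2) * u ρ =
      -∫ ρ in (0 : ℝ)..R, 2 * ρ * deriv θ (ρ ^ 2) * ∫ x in (0 : ℝ)..ρ, u x := by
  have hcont : Continuous fun ρ : ℝ => 2 * ρ * deriv θ (ρ ^ 2) := by
    have := hθ.continuous_deriv
    fun_prop
  rw [intervalIntegral.integral_mul_deriv_eq_deriv_mul (u := fun ρ => θ (ρ ^ 2))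
    (fun ρ _ => hθ.hasDerivAt_comp_sq ρ)
    (fun ρ _ => (hu.integral_hasStrictDerivAt 0 ρ).hasDerivAt)
    (hcont.intervalIntegrable _ _) (hu.intervalIntegrable _ _)]
  simp [hθ.apply_radius_sq]

/-- The radial form of the outer variation identity. -/
lemma boundary_term_eq_energy {R : ℝ} {k : ℕ} {A E : ℝ → ℝ} (hA : Continuous A)
    (hE : Continuous E)
    (h : ∀ θ, IsRadialCutoff R θ → ∫ ρ in (0 : ℝ)..R,
      ρ ^ k * (θ (ρ ^ 2) * A ρ + 2 * ρ * deriv θ (ρ ^ 2) * E ρ) = 0)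
    {r : ℝ} (hr : 0 < r) (hrR : r < R) :
    r ^ k * E r = ∫ ρ in (0 : ℝ)..r, ρ ^ k * A ρ := by
  have hu : Continuous fun ρ => ρ ^ k * A ρ := by fun_prop
  have hprim : Continuous fun r => ∫ ρ in (0 : ℝ)..r, ρ ^ k * A ρ :=
    intervalIntegral.continuous_primitive (fun _ _ => hu.intervalIntegrable _ _) 0
  have := eq_zero_of_forall_isRadialCutoff (R := R)
    (w := fun r => r ^ k * E r - ∫ ρ in (0 : ℝ)..r, ρ ^ k * A ρ) (by fun_prop)
    (fun θ hθ => ?_) hr hrR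
  · linarith
  have hc := hθ.continuous_deriv
  have hc' := hθ.contDiff.continuous
  have h1 := h θ hθ
  have h2 := integral_cutoff_mul_eq hθ hu
  simp only [mul_add, mul_sub] at h1 ⊢
  rw [intervalIntegral.integral_add (Continuous.intervalIntegrable (by fun_prop) _ _)
    (Continuous.intervalIntegrable (by fun_prop) _ _)] at h1
  rw [intervalIntegral.integral_sub (Continuous.intervalIntegrable (by fun_prop) _ _)
    (Continuous.intervalIntegrable (by fun_prop) _ _)]
  have e1 : ∫ ρ in (0 : ℝ)..R, ρ ^ k * (θ (ρ ^ 2) * A ρ) =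
      ∫ ρ in (0 : ℝ)..R, θ (ρ ^ 2) * (ρ ^ k * A ρ) := by congr 1; ext; ring
  have e2 : ∫ ρ in (0 : ℝ)..R, ρ ^ k * (2 * ρ * deriv θ (ρ ^ 2) * E ρ) =
      ∫ ρ in (0 : ℝ)..R, 2 * ρ * deriv θ (ρ ^ 2) * (ρ ^ k * E ρ) := by congr 1; ext; ring
  linarith

/-- The radial form of the inner variation identity. -/
lemma sphere_energy_eq {R : ℝ} {n : ℕ} {A B : ℝ → ℝ} (hA : Continuous A) (hB : Continuous B)
    (h : ∀ θ, IsRadialCutoff R θ → ∫ ρ in (0 : ℝ)..R, ρ ^ (n + 1) *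
      ((-(n * θ (ρ ^ 2)) - ρ * (2 * ρ * deriv θ (ρ ^ 2))) * A ρ +
        2 * (ρ * (2 * ρ * deriv θ (ρ ^ 2))) * B ρ) = 0)
    {r : ℝ} (hr : 0 < r) (hrR : r < R) :
    r ^ (n + 2) * A r = n * (∫ ρ in (0 : ℝ)..r, ρ ^ (n + 1) * A ρ) + 2 * (r ^ (n + 2) * B r) := by
  have hu : Continuous fun ρ => ρ ^ (n + 1) * A ρ := by fun_prop
  have hprim : Continuous fun r => ∫ ρ in (0 : ℝ)..r, ρ ^ (n + 1) * A ρ :=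
    intervalIntegral.continuous_primitive (fun _ _ => hu.intervalIntegrable _ _) 0
  have := eq_zero_of_forall_isRadialCutoff (R := R)
    (w := fun r => n * (∫ ρ in (0 : ℝ)..r, ρ ^ (n + 1) * A ρ) +
      (2 * (r ^ (n + 2) * B r) - r ^ (n + 2) * A r)) (by fun_prop)
    (fun θ hθ => ?_) hr hrR
  · linarith
  have hc := hθ.continuous_deriv
  have hc' := hθ.contDiff.continuous
  have h1 := h θ hθ
  have h2 := integral_cutoff_mul_eq hθ hu
  have e1 : ∀ ρ, ρ ^ (n + 1) * ((-(n * θ (ρ ^ 2)) - ρ * (2 * ρ * deriv θ (ρ ^ 2))) * A ρ +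
        2 * (ρ * (2 * ρ * deriv θ (ρ ^ 2))) * B ρ) = (-n) * (θ (ρ ^ 2) * (ρ ^ (n + 1) * A ρ)) +
      2 * ρ * deriv θ (ρ ^ 2) * (2 * (ρ ^ (n + 2) * B ρ) - ρ ^ (n + 2) * A ρ) := fun ρ => by ring
  have e2 : ∀ ρ, 2 * ρ * deriv θ (ρ ^ 2) * (n * (∫ x in (0 : ℝ)..ρ, x ^ (n + 1) * A x) +
      (2 * (ρ ^ (n + 2) * B ρ) - ρ ^ (n + 2) * A ρ)) =
      n * (2 * ρ * deriv θ (ρ ^ 2) * ∫ x in (0 : ℝ)..ρ, x ^ (n + 1) * A x) +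
      2 * ρ * deriv θ (ρ ^ 2) * (2 * (ρ ^ (n + 2) * B ρ) - ρ ^ (n + 2) * A ρ) := fun ρ => by ring
  simp_rw [e1] at h1
  simp_rw [e2]
  rw [intervalIntegral.integral_add (Continuous.intervalIntegrable (by fun_prop) _ _)
    (Continuous.intervalIntegrable (by fun_prop) _ _), intervalIntegral.integral_const_mul] at h1 ⊢
  rw [h2] at h1
  linarith

/-- The derivative of the energy along a radial deformation. -/
lemma hasDerivAt_radial_energy {R : ℝ} {n : ℕ} {A B η η' : ℝ → ℝ} (hA : Continuous A)
    (hB : Continuous B) (hη : ∀ ρ, HasDerivAt η (η' ρ) ρ) (hη' : Continuous η') (hηR : η R = 0) :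
    HasDerivAt (fun t : ℝ => ∫ ρ in (0 : ℝ)..R, ρ ^ (n + 1) *
        ((1 + t * η ρ) ^ 2 * A (ρ * (1 + t * η ρ)) +
          ((1 + t * η ρ + t * (ρ * η' ρ)) ^ 2 - (1 + t * η ρ) ^ 2) * B (ρ * (1 + t * η ρ))))
      (∫ ρ in (0 : ℝ)..R, ρ ^ (n + 1) *
        ((-(n * η ρ) - ρ * η' ρ) * A ρ + 2 * (ρ * η' ρ) * B ρ)) 0 := by
  have hηc : Continuous η := continuous_iff_continuousAt.2 fun ρ => (hη ρ).continuousAt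
  let q : ℝ → ℝ → ℝ := fun t ρ => ρ ^ (n + 1) *
    ((-((1 + t * η ρ) ^ 2 * η ρ * ∑ j ∈ Finset.range n, (1 + t * η ρ) ^ j)
      - (1 + t * η ρ) ^ (n + 1) * (ρ * η' ρ)) * A (ρ * (1 + t * η ρ)) +
      ρ * η' ρ * (2 * (1 + t * η ρ) + t * (ρ * η' ρ)) * B (ρ * (1 + t * η ρ)))
  have hq : Continuous (Function.uncurry q) := by
    simp only [q, Function.uncurry_def]
    fun_prop
  have hQ : Continuous fun t => ∫ ρ in (0 : ℝ)..R, q t ρ :=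
    intervalIntegral.continuous_parametric_intervalIntegral_of_continuous' hq 0 R
  have hsubst : ∀ t : ℝ, ∫ ρ in (0 : ℝ)..R, (ρ * (1 + t * η ρ)) ^ (n + 1) *
      A (ρ * (1 + t * η ρ)) * (1 + t * η ρ + t * (ρ * η' ρ)) =
      ∫ s in (0 : ℝ)..R, s ^ (n + 1) * A s := by
    intro t
    have hd : ∀ ρ ∈ Set.uIcc 0 R, HasDerivAt (fun ρ => ρ * (1 + t * η ρ))
        (1 + t * η ρ + t * (ρ * η' ρ)) ρ := fun ρ _ => by
      refine ((hasDerivAt_id ρ).mul (((hη ρ).const_mul t).const_add 1)).congr_deriv ?_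
      simp only [id]
      ring
    have := intervalIntegral.integral_comp_mul_deriv (g := fun s => s ^ (n + 1) * A s) hd
      (by fun_prop) (by fun_prop)
    simpa [hηR] using this
  have hsplit : ∀ t : ℝ, (∫ ρ in (0 : ℝ)..R, ρ ^ (n + 1) *
        ((1 + t * η ρ) ^ 2 * A (ρ * (1 + t * η ρ)) +
          ((1 + t * η ρ + t * (ρ * η' ρ)) ^ 2 - (1 + t * η ρ) ^ 2) * B (ρ * (1 + t * η ρ)))) =
      (∫ s in (0 : ℝ)..R, s ^ (n + 1) * A s) + t * ∫ ρ in (0 : ℝ)..R, q t ρ := by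
    intro t
    have hqt : Continuous (q t) := hq.comp (by fun_prop : Continuous fun ρ : ℝ => (t, ρ))
    rw [← hsubst t, ← intervalIntegral.integral_const_mul, ← intervalIntegral.integral_add
      (Continuous.intervalIntegrable (by fun_prop) _ _)
      (Continuous.intervalIntegrable (by fun_prop) _ _)]
    congr 1
    ext ρ
    have hgeom : (∑ j ∈ Finset.range n, (1 + t * η ρ) ^ j) * (t * η ρ) =
        (1 + t * η ρ) ^ n - 1 := by
      have := geom_sum_mul (1 + t * η ρ) n
      rwa [add_sub_cancel_left] at this
    simp only [q, mul_pow]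
    linear_combination ρ ^ (n + 1) * (1 + t * η ρ) ^ 2 * A (ρ * (1 + t * η ρ)) * hgeom
  have hderiv : HasDerivAt (fun t => (∫ s in (0 : ℝ)..R, s ^ (n + 1) * A s) +
      t * ∫ ρ in (0 : ℝ)..R, q t ρ) (∫ ρ in (0 : ℝ)..R, q 0 ρ) 0 := by
    refine HasDerivAt.const_add _ ?_
    rw [hasDerivAt_iff_tendsto_slope]
    refine ((hQ.tendsto 0).mono_left nhdsWithin_le_nhds).congr' ?_
    filter_upwards [self_mem_nhdsWithin] with t ht
    have : t ≠ 0 := ht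
    simp [slope, this]
  have hval : ∫ ρ in (0 : ℝ)..R, q 0 ρ = ∫ ρ in (0 : ℝ)..R, ρ ^ (n + 1) *
        ((-(n * η ρ) - ρ * η' ρ) * A ρ + 2 * (ρ * η' ρ) * B ρ) := by
    congr 1
    ext ρ
    simp only [q, zero_mul, add_zero, one_pow, mul_one, one_mul, Finset.sum_const,
      Finset.card_range, nsmul_eq_mul]
    ring
  rw [← hval]
  exact hderiv.congr_of_eventuallyEq (Filter.Eventually.of_forall hsplit)

/-- Almgren monotonicity of the frequency, as a statement on ordinary differential equations. -/
lemma monotoneOn_frequency {n : ℕ} {r₀ : ℝ} {h A B E D : ℝ → ℝ}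
    (hh : ∀ r ∈ Set.Ioc 0 r₀, HasDerivAt h (2 * E r) r)
    (hD : ∀ r ∈ Set.Ioc 0 r₀, HasDerivAt D (r ^ (n + 1) * A r) r)
    (hDE : ∀ r ∈ Set.Ioc 0 r₀, r ^ (n + 1) * E r = D r)
    (hAB : ∀ r ∈ Set.Ioc 0 r₀, r ^ (n + 2) * A r = n * D r + 2 * (r ^ (n + 2) * B r))
    (hCS : ∀ r ∈ Set.Ioc 0 r₀, E r ^ 2 ≤ h r * B r)
    (hpos : ∀ r ∈ Set.Ioc 0 r₀, 0 < h r) :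
    MonotoneOn (fun r => D r / (r ^ n * h r)) (Set.Ioc 0 r₀) := by
  have hder : ∀ r ∈ Set.Ioc 0 r₀, HasDerivAt (fun r => D r / (r ^ n * h r))
      ((r ^ (n + 1) * A r * (r ^ n * h r) - D r * (n * r ^ (n - 1) * h r + r ^ n * (2 * E r))) /
        (r ^ n * h r) ^ 2) r := fun r hr =>
    (hD r hr).div ((hasDerivAt_pow n r).mul (hh r hr))
      (mul_ne_zero (pow_ne_zero _ hr.1.ne') (hpos r hr).ne')
  refine monotoneOn_of_deriv_nonneg (convex_Ioc 0 r₀)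
    (fun r hr => (hder r hr).continuousAt.continuousWithinAt)
    (fun r hr => ?_) (fun r hr => ?_)
  · exact (hder r (interior_subset hr)).differentiableAt.differentiableWithinAt
  · have hr' := interior_subset hr
    rw [(hder r hr').deriv]
    refine div_nonneg ?_ (sq_nonneg _)
    refine nonneg_of_mul_nonneg_right ?_ hr'.1
    have hn : (n : ℝ) * r ^ (n - 1) * r = n * r ^ n := by
      cases n with
      | zero => simp
      | succ k => rw [Nat.add_sub_cancel, pow_succ]; ring
    have key : r * (r ^ (n + 1) * A r * (r ^ n * h r) -
        D r * (n * r ^ (n - 1) * h r + r ^ n * (2 * E r))) =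
        2 * (r ^ (n + 1)) ^ 2 * (h r * B r - E r ^ 2) := by
      linear_combination (r ^ n * h r) * hAB r hr' - D r * h r * hn +
        2 * r ^ (n + 1) * E r * hDE r hr'
    rw [key]
    have := hCS r hr'
    have := hr'.1
    exact mul_nonneg (by positivity) (by linarith)

/-- Growth of the spherical mean in terms of the frequency. -/
lemma spherical_mean_le {n : ℕ} {r₀ : ℝ} {h E D : ℝ → ℝ}
    (hh : ∀ r ∈ Set.Ioc 0 r₀, HasDerivAt h (2 * E r) r)
    (hDE : ∀ r ∈ Set.Ioc 0 r₀, r ^ (n + 1) * E r = D r)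
    (hpos : ∀ r ∈ Set.Ioc 0 r₀, 0 < h r)
    (hmono : MonotoneOn (fun r => D r / (r ^ n * h r)) (Set.Ioc 0 r₀))
    {r : ℝ} (hr : r ∈ Set.Ioc 0 r₀) :
    h r ≤ (r / r₀) ^ (2 * (D r / (r ^ n * h r))) * h r₀ := by
  have hr0 : 0 < r₀ := hr.1.trans_le hr.2
  set N := D r / (r ^ n * h r) with hN
  have hmem : ∀ s ∈ Set.Icc r r₀, s ∈ Set.Ioc 0 r₀ := fun s hs => ⟨hr.1.trans_le hs.1, hs.2⟩
  have hder : ∀ s ∈ Set.Icc r r₀, HasDerivAt (fun s => Real.log (h s) - 2 * N * Real.log s)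
      (2 * E s / h s - 2 * N * s⁻¹) s := fun s hs =>
    ((hh s (hmem s hs)).log (hpos s (hmem s hs)).ne').sub
      ((Real.hasDerivAt_log (hmem s hs).1.ne').const_mul _)
  have hm : MonotoneOn (fun s => Real.log (h s) - 2 * N * Real.log s) (Set.Icc r r₀) := by
    refine monotoneOn_of_deriv_nonneg (convex_Icc r r₀)
      (fun s hs => (hder s hs).continuousAt.continuousWithinAt)
      (fun s hs => (hder s (interior_subset hs)).differentiableAt.differentiableWithinAt)
      (fun s hs => ?_)
    have hs' := interior_subset hs
    have hs0 := (hmem s hs').1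
    have hhs := hpos s (hmem s hs')
    rw [(hder s hs').deriv]
    have hNs : N ≤ D s / (s ^ n * h s) := hmono hr (hmem s hs') hs'.1
    have : 2 * E s / h s - 2 * N * s⁻¹ = 2 * (D s / (s ^ n * h s) - N) * s⁻¹ := by
      rw [← hDE s (hmem s hs')]
      field_simp
      ring
    rw [this]
    exact mul_nonneg (by linarith) (inv_nonneg.2 hs0.le)
  have hlog := hm (Set.left_mem_Icc.2 hr.2) (Set.right_mem_Icc.2 hr.2) hr.2
  have hx : 0 < r / r₀ := div_pos hr.1 hr0
  have hh0 := hpos r₀ ⟨hr0, le_rfl⟩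
  have hp : 0 < (r / r₀) ^ (2 * N) := Real.rpow_pos_of_pos hx _
  rw [← Real.log_le_log_iff (hpos r hr) (mul_pos hp hh0),
    Real.log_mul hp.ne' hh0.ne', Real.log_rpow hx, Real.log_div hr.1.ne' hr0.ne']
  simp only at hlog
  linarith

/-- Energy decay, for a frequency normalised by a constant `C ≥ 1`. -/
lemma energy_decay_of_spherical_mean_le {n : ℕ} {r r₀ C : ℝ} {h D H : ℝ → ℝ} (hr : 0 < r)
    (hrr₀ : r ≤ r₀) (hC : 1 ≤ C)
    (hH : ∀ ρ ∈ Set.Ioc 0 r₀, H ρ = C * (ρ ^ (n + 1) * h ρ))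
    (hpos : ∀ ρ ∈ Set.Ioc 0 r₀, 0 < h ρ) (hD : 0 ≤ D r) (hD₀ : 0 < D r₀)
    (hle : h r ≤ (r / r₀) ^ (2 * (D r / (r ^ n * h r))) * h r₀) :
    D r / r ^ n ≤ (r / r₀) ^ (2 * (r * D r / H r)) * (D r₀ / r₀ ^ n) *
      ((r * D r / H r) / (r₀ * D r₀ / H r₀)) := by
  have hr₀ : 0 < r₀ := hr.trans_le hrr₀
  have hh := hpos r ⟨hr, hrr₀⟩
  have hh₀ := hpos r₀ ⟨hr₀, le_rfl⟩
  have hC0 : 0 < C := by linarith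
  set N := D r / (r ^ n * h r) with hN
  have hN0 : 0 ≤ N := by positivity
  have hNr : r * D r / H r = N / C := by
    rw [hH r ⟨hr, hrr₀⟩, hN]
    field_simp
    ring
  have hexp : h r ≤ (r / r₀) ^ (2 * (N / C)) * h r₀ := by
    refine hle.trans (mul_le_mul_of_nonneg_right ?_ hh₀.le)
    refine Real.rpow_le_rpow_of_exponent_ge (div_pos hr hr₀) ((div_le_one hr₀).2 hrr₀) ?_
    have := div_le_self hN0 hC
    linarith
  have hlhs : D r / r ^ n = N * h r := by
    rw [hN]
    field_simp
  have hrhs : (D r₀ / r₀ ^ n) * ((N / C) / (r₀ * D r₀ / H r₀)) = N * h r₀ := by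
    rw [hH r₀ ⟨hr₀, le_rfl⟩]
    field_simp
    ring
  rw [hNr, mul_assoc, hrhs, hlhs]
  calc N * h r ≤ N * ((r / r₀) ^ (2 * (N / C)) * h r₀) := mul_le_mul_of_nonneg_left hexp hN0
    _ = _ := by ring

lemma continuous_hsNormSq {m : ℕ} : Continuous (hsNormSq (m := m)) := by
  unfold hsNormSq
  fun_prop

lemma hsNormSq_nonneg {m : ℕ} (A : Em m →L[ℝ] ell2) : 0 ≤ hsNormSq A :=
  Finset.sum_nonneg fun _ _ => sq_nonneg _

lemma hsNormSq_add_smul {m : ℕ} (A B : Em m →L[ℝ] ell2) (t : ℝ) :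
    hsNormSq (A + t • B) = hsNormSq A + t * (2 * hsInner A B) + t ^ 2 * hsNormSq B := by
  simp only [hsNormSq, hsInner, Finset.mul_sum, ← Finset.sum_add_distrib]
  refine Finset.sum_congr rfl fun i _ => ?_
  rw [add_apply, smul_apply, norm_add_sq_real,
    inner_smul_right, norm_smul, mul_pow, Real.norm_eq_abs, sq_abs]
  ring

lemma sum_smul_single {m : ℕ} (w : Em m) :
    ∑ i, w i • EuclideanSpace.single i (1 : ℝ) = w := by
  simpa using (EuclideanSpace.basisFun (Fin m) ℝ).sum_repr w

lemma hsInner_smul_add_smulRight {m : ℕ} (A : Em m →L[ℝ] ell2) (c d : ℝ) (w : Em m) (v : ell2) :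
    hsInner A (c • A + (d • innerSL ℝ w).smulRight v) = c * hsNormSq A + d * ⟪v, A w⟫ := by
  have hw : ⟪v, A w⟫ = ∑ i, w i * ⟪v, A (EuclideanSpace.single i 1)⟫ := by
    conv_lhs => rw [← sum_smul_single w]
    simp [map_sum, inner_sum, inner_smul_right]
  rw [hw]
  simp only [hsNormSq, hsInner, Finset.mul_sum, ← Finset.sum_add_distrib]
  refine Finset.sum_congr rfl fun i _ => ?_
  simp only [add_apply, smul_apply,
    ContinuousLinearMap.smulRight_apply, innerSL_apply_apply, inner_add_right, inner_smul_right,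
    real_inner_self_eq_norm_sq, EuclideanSpace.inner_single_right, smul_eq_mul]
  rw [real_inner_comm v]
  simp
  ring

lemma hasFDerivAt_comp_norm_sub_sq {E : Type*} [NormedAddCommGroup E] [InnerProductSpace ℝ E]
    {θ : ℝ → ℝ} {θ' : ℝ} {a x : E} (hθ : HasDerivAt θ θ' (‖x - a‖ ^ 2)) :
    HasFDerivAt (fun x => θ (‖x - a‖ ^ 2)) ((2 * θ') • innerSL ℝ (x - a)) x := by
  have h1 : HasFDerivAt (fun x : E => ‖x - a‖ ^ 2) (2 • innerSL ℝ (x - a)) x := by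
    simpa using ((hasFDerivAt_id x).sub_const a).norm_sq
  refine (hθ.comp_hasFDerivAt x h1).congr_fderiv ?_
  ext v
  simp
  ring

/-- A smooth bounded map with bounded derivative that is the identity on a given ball. -/
lemma exists_contDiff_truncation (M : ℝ) : ∃ T : ell2 → ell2, ContDiff ℝ 1 T ∧
    (∃ C, ∀ y, ‖T y‖ ≤ C) ∧ (∃ C, ∀ y, ‖fderiv ℝ T y‖ ≤ C) ∧ ∀ y, ‖y‖ ≤ M → T y = y := by
  let ψ : ContDiffBump (0 : ℝ) := ⟨M ^ 2 + 1, M ^ 2 + 2, by positivity, by linarith⟩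
  have hψ : ContDiff ℝ 1 ψ := ψ.contDiff
  have hψc : HasCompactSupport ψ := ψ.hasCompactSupport
  have hψd : ∀ s, HasDerivAt ψ (deriv ψ s) s := fun s =>
    (hψ.differentiable (by simp) s).hasDerivAt
  have hTd : ∀ y : ell2, HasFDerivAt (fun y : ell2 => ψ (‖y‖ ^ 2) • y)
      (ψ (‖y‖ ^ 2) • ContinuousLinearMap.id ℝ ell2 +
        ((2 * deriv ψ (‖y‖ ^ 2)) • innerSL ℝ y).smulRight y) y := fun y => by
    have h := hasFDerivAt_comp_norm_sub_sq (a := (0 : ell2)) (x := y) (hψd (‖y - 0‖ ^ 2))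
    simp only [sub_zero] at h
    exact h.smul (hasFDerivAt_id y)
  have hbd : ∀ g : ℝ → ℝ, Continuous g → HasCompactSupport g → ∃ C, ∀ s, |g s| ≤ C :=
    fun g hg hgc => hg.bounded_above_of_compact_support hgc
  refine ⟨fun y => ψ (‖y‖ ^ 2) • y, ?_, ?_, ?_, ?_⟩
  · exact (hψ.comp (contDiff_norm_sq ℝ)).smul contDiff_id
  · obtain ⟨C, hC⟩ := hbd (fun s => ψ s * √|s|)
      (hψ.continuous.mul (by fun_prop)) (hψc.mul_right)
    refine ⟨C, fun y => ?_⟩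
    have := hC (‖y‖ ^ 2)
    rwa [abs_mul, abs_of_nonneg (sq_nonneg ‖y‖), Real.sqrt_sq (norm_nonneg y), abs_norm,
      ← Real.norm_eq_abs, ← norm_smul] at this
  · obtain ⟨C, hC⟩ := hbd ψ hψ.continuous hψc
    obtain ⟨C', hC'⟩ := hbd (fun s => deriv ψ s * s)
      ((hψ.continuous_deriv le_rfl).mul continuous_id) (hψc.deriv.mul_right)
    refine ⟨C + 2 * C', fun y => ?_⟩
    rw [(hTd y).fderiv]
    refine (norm_add_le _ _).trans (add_le_add ?_ ?_)
    · rw [norm_smul]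
      calc _ ≤ |ψ (‖y‖ ^ 2)| * 1 :=
            mul_le_mul_of_nonneg_left ContinuousLinearMap.norm_id_le (abs_nonneg _)
        _ ≤ C := by simpa using hC (‖y‖ ^ 2)
    · rw [ContinuousLinearMap.norm_smulRight_apply, norm_smul, innerSL_apply_norm]
      have := hC' (‖y‖ ^ 2)
      rw [abs_mul, abs_of_nonneg (sq_nonneg ‖y‖)] at this
      rw [Real.norm_eq_abs, abs_mul, abs_two]
      linarith
  · intro y hy
    have : ψ (‖y‖ ^ 2) = 1 := ψ.one_of_mem_closedBall (by
      rw [mem_closedBall_zero_iff, Real.norm_eq_abs, abs_of_nonneg (sq_nonneg _)]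
      have : ‖y‖ ^ 2 ≤ M ^ 2 := pow_le_pow_left₀ (norm_nonneg y) hy 2
      change _ ≤ M ^ 2 + 1
      linarith)
    simp [this]

lemma exists_bound_fderiv_smul {E F : Type*} [NormedAddCommGroup E] [NormedSpace ℝ E]
    [NormedAddCommGroup F] [NormedSpace ℝ F] {φ : E → ℝ} {T : F → F} (hφ : ContDiff ℝ 1 φ)
    (hT : ContDiff ℝ 1 T) (h1 : ∃ C, ∀ x, |φ x| ≤ C) (h2 : ∃ C, ∀ x, ‖fderiv ℝ φ x‖ ≤ C)
    (h3 : ∃ C, ∀ y, ‖T y‖ ≤ C) (h4 : ∃ C, ∀ y, ‖fderiv ℝ T y‖ ≤ C) :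
    ∃ C, ∀ p : E × F, ‖fderiv ℝ (fun p : E × F => φ p.1 • T p.2) p‖ ≤ C := by
  obtain ⟨C₁, h1⟩ := h1
  obtain ⟨C₂, h2⟩ := h2
  obtain ⟨C₃, h3⟩ := h3
  obtain ⟨C₄, h4⟩ := h4
  refine ⟨C₁ * C₄ + C₂ * C₃, fun p => ?_⟩
  have hd1 : HasFDerivAt (fun p : E × F => φ p.1)
      ((fderiv ℝ φ p.1).comp (ContinuousLinearMap.fst ℝ E F)) p :=
    (hφ.differentiable (by simp) p.1).hasFDerivAt.comp p hasFDerivAt_fst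
  have hd2 : HasFDerivAt (fun p : E × F => T p.2)
      ((fderiv ℝ T p.2).comp (ContinuousLinearMap.snd ℝ E F)) p :=
    (hT.differentiable (by simp) p.2).hasFDerivAt.comp p hasFDerivAt_snd
  rw [(hd1.fun_smul hd2).fderiv]
  refine (norm_add_le _ _).trans (add_le_add ?_ ?_)
  · rw [norm_smul]
    refine mul_le_mul (h1 _) ?_ (norm_nonneg _) ((abs_nonneg _).trans (h1 p.1))
    refine (ContinuousLinearMap.opNorm_comp_le _ _).trans ?_
    simpa using mul_le_mul (h4 p.2) (ContinuousLinearMap.norm_snd_le ℝ E F)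
      (norm_nonneg _) ((norm_nonneg _).trans (h4 p.2))
  · rw [ContinuousLinearMap.norm_smulRight_apply]
    refine mul_le_mul ?_ (h3 _) (norm_nonneg _) ((norm_nonneg _).trans (h2 p.1))
    refine (ContinuousLinearMap.opNorm_comp_le _ _).trans ?_
    simpa using mul_le_mul (h2 p.1) (ContinuousLinearMap.norm_fst_le ℝ E F)
      (norm_nonneg _) ((norm_nonneg _).trans (h2 p.1))

lemma setIntegral_quadratic {E : Type*} [MeasurableSpace E] {μ : Measure E} {s : Set E}
    {u v w : E → ℝ} (hu : IntegrableOn u s μ) (hv : IntegrableOn v s μ) (hw : IntegrableOn w s μ)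
    (t : ℝ) : ∫ x in s, (u x + t * v x + t ^ 2 * w x) ∂μ =
      (∫ x in s, u x ∂μ) + t * (∫ x in s, v x ∂μ) + t ^ 2 * ∫ x in s, w x ∂μ := by
  rw [integral_add, integral_add, integral_const_mul, integral_const_mul]
  exacts [hu, hv.const_mul t, hu.add (hv.const_mul t), hw.const_mul _]

namespace IsRadialCutoff

variable {R : ℝ} {θ : ℝ → ℝ}

lemma deriv_eq_zero (hθ : IsRadialCutoff R θ) {s : ℝ} (hs : R ^ 2 ≤ s) : deriv θ s = 0 := by
  obtain ⟨r₁, h0, h1, h2⟩ := hθ.vanish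
  have hlt : r₁ ^ 2 < s := (pow_lt_pow_left₀ h1 h0.le two_ne_zero).trans_le hs
  have : θ =ᶠ[𝓝 s] fun _ => 0 := by
    filter_upwards [eventually_gt_nhds hlt] with u hu using h2 u hu.le
  rw [this.deriv_eq, deriv_const]

lemma eq_zero (hθ : IsRadialCutoff R θ) {s : ℝ} (hs : R ^ 2 ≤ s) : θ s = 0 := by
  obtain ⟨r₁, h0, h1, h2⟩ := hθ.vanish
  exact h2 s ((pow_lt_pow_left₀ h1 h0.le two_ne_zero).le.trans hs)

lemma sq_le_of_notMem_ball {m : ℕ} {a x : Em m} (hR : 0 ≤ R) (hx : x ∉ ball a R) :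
    R ^ 2 ≤ ‖x - a‖ ^ 2 := by
  rw [mem_ball_iff_norm, not_lt] at hx
  exact pow_le_pow_left₀ hR hx 2

lemma pos (hθ : IsRadialCutoff R θ) : 0 < R := by
  obtain ⟨r₁, h0, h1, -⟩ := hθ.vanish
  exact h0.trans h1

lemma contDiff_comp_norm {m : ℕ} (hθ : IsRadialCutoff R θ) (a : Em m) :
    ContDiff ℝ (⊤ : ℕ∞) fun x : Em m => θ (‖x - a‖ ^ 2) :=
  hθ.contDiff.comp ((contDiff_norm_sq ℝ).comp (contDiff_id.sub contDiff_const))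

lemma hasCompactSupport_comp_norm {m : ℕ} (hθ : IsRadialCutoff R θ) (a : Em m) :
    HasCompactSupport fun x : Em m => θ (‖x - a‖ ^ 2) := by
  refine HasCompactSupport.intro (isCompact_closedBall a R) fun x hx => ?_
  exact hθ.eq_zero (sq_le_of_notMem_ball hθ.pos.le fun h => hx (ball_subset_closedBall h))

end IsRadialCutoff

section outerVariation

variable {m : ℕ} {U : Set (Em m)} {f : Em m → ell2} {f' : Em m → (Em m →L[ℝ] ell2)} {a : Em m}
  {R : ℝ}

/-- First variation of the energy in a direction supported in a ball. -/
lemma setIntegral_hsInner_eq_zero (hU : IsOpen U) (hf'c : ContinuousOn f' U)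
    (hfin : IntegrableOn (fun x => hsNormSq (f' x)) U volume) (hK : closedBall a R ⊆ U)
    {G : Em m → (Em m →L[ℝ] ell2)} (hGc : ContinuousOn G U) (hG0 : ∀ x, x ∉ ball a R → G x = 0)
    (hder : HasDerivAt (fun t : ℝ => ∫ x in U, hsNormSq (f' x + t • G x)) 0 0) :
    ∫ x in ball a R, hsInner (f' x) (G x) = 0 := by
  have hint : ∀ g : Em m → ℝ, ContinuousOn g U → (∀ x, x ∉ ball a R → g x = 0) →
      IntegrableOn g U := fun g hg hg0 =>
    (((hg.mono hK).integrableOn_compact (isCompact_closedBall a R)).mono_set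
      ball_subset_closedBall).of_forall_sdiff_eq_zero hU.measurableSet fun x hx => hg0 x hx.2
  have hI1 : ContinuousOn (fun x => hsInner (f' x) (G x)) U := by
    unfold hsInner
    fun_prop
  have hi1 : IntegrableOn (fun x => hsInner (f' x) (G x)) U :=
    hint _ hI1 fun x hx => by simp [hG0 x hx, hsInner]
  have hi2 : IntegrableOn (fun x => hsNormSq (G x)) U :=
    hint _ (continuous_hsNormSq.comp_continuousOn hGc) fun x hx => by simp [hG0 x hx, hsNormSq]
  have hquad : ∀ t : ℝ, ∫ x in U, hsNormSq (f' x + t • G x) =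
      (∫ x in U, hsNormSq (f' x)) + t * (∫ x in U, 2 * hsInner (f' x) (G x)) +
        t ^ 2 * ∫ x in U, hsNormSq (G x) := by
    intro t
    simp_rw [hsNormSq_add_smul]
    exact setIntegral_quadratic hfin (hi1.const_mul 2) hi2 t
  simp only [hquad] at hder
  have hder2 : ∀ c₀ c₁ c₂ : ℝ, HasDerivAt (fun t : ℝ => c₀ + t * c₁ + t ^ 2 * c₂) c₁ 0 :=
    fun c₀ c₁ c₂ => by
      refine ((((hasDerivAt_id (0 : ℝ)).mul_const c₁).const_add c₀).add
        ((hasDerivAt_pow 2 (0 : ℝ)).mul_const c₂)).congr_deriv ?_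
      simp
  have hzero := (hder2 _ _ _).unique hder
  rw [integral_const_mul] at hzero
  rw [← setIntegral_eq_of_subset_of_forall_sdiff_eq_zero hU.measurableSet
    (ball_subset_closedBall.trans hK) fun x hx => by simp [hG0 x hx.2, hsInner]]
  linarith

/-- The outer variation along radial rescalings of `f`. -/
lemma SquashStationary.integral_radial_eq_zero (hU : IsOpen U)
    (hf : ∀ x ∈ U, HasFDerivAt f (f' x) x) (hf'c : ContinuousOn f' U)
    (hfin : IntegrableOn (fun x => hsNormSq (f' x)) U volume)
    (hsquash : SquashStationary U f) (hK : closedBall a R ⊆ U) {θ : ℝ → ℝ}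
    (hθ : IsRadialCutoff R θ) :
    ∫ x in ball a R, (θ (‖x - a‖ ^ 2) * hsNormSq (f' x) +
      2 * deriv θ (‖x - a‖ ^ 2) * ⟪f x, f' x (x - a)⟫) = 0 := by
  have hR := hθ.pos
  have hfc : ContinuousOn f U := fun x hx => (hf x hx).continuousAt.continuousWithinAt
  obtain ⟨M, hM⟩ := (isCompact_closedBall a R).exists_bound_of_continuousOn (hfc.mono hK)
  obtain ⟨T, hT, ⟨C, hC⟩, ⟨C', hC'⟩, hTid⟩ := exists_contDiff_truncation M
  set φ : Em m → ℝ := fun x => θ (‖x - a‖ ^ 2) with hφ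
  have hφs : ContDiff ℝ 1 φ := (hθ.contDiff_comp_norm a).of_le (by simp)
  have hφc : HasCompactSupport φ := hθ.hasCompactSupport_comp_norm a
  have hφ1 : ∀ x, |φ x| ≤ 1 := fun x => by
    rw [abs_of_nonneg (hθ.nonneg _)]
    exact hθ.le_one _
  obtain ⟨C'', hC''⟩ := (hφs.continuous_fderiv one_ne_zero).bounded_above_of_compact_support
    (hφc.fderiv ℝ)
  have hφ0 : ∀ x, x ∉ ball a R → φ x = 0 := fun x hx =>
    hθ.eq_zero (IsRadialCutoff.sq_le_of_notMem_ball hR.le hx)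
  have hsupp : closure {x : Em m | ∃ y, φ x • T y ≠ 0} ⊆ closedBall a R := by
    refine closure_minimal ?_ isClosed_closedBall
    rintro x ⟨y, hy⟩
    by_contra hx
    exact hy (by simp [hφ0 x fun h => hx (ball_subset_closedBall h)])
  have hder := hsquash (fun p => φ p.1 • T p.2)
    ((hφs.comp contDiff_fst).smul (hT.comp contDiff_snd))
    ⟨1 * C, fun p => by
      rw [norm_smul]
      exact mul_le_mul (hφ1 _) (hC _) (norm_nonneg _) zero_le_one⟩
    (exists_bound_fderiv_smul hφs hT ⟨1, hφ1⟩ ⟨C'', hC''⟩ ⟨C, hC⟩ ⟨C', hC'⟩)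
    ((isCompact_closedBall a R).of_isClosed_subset isClosed_closure hsupp)
    (hsupp.trans hK)
  have hYf : ∀ z, φ z • T (f z) = φ z • f z := fun z => by
    by_cases hz : z ∈ ball a R
    · rw [hTid _ (hM z (ball_subset_closedBall hz))]
    · simp [hφ0 z hz]
  simp only [hYf] at hder
  set G : Em m → (Em m →L[ℝ] ell2) := fun x => φ x • f' x +
    ((2 * deriv θ (‖x - a‖ ^ 2)) • innerSL ℝ (x - a)).smulRight (f x) with hG
  have hGc : ContinuousOn G U := by
    have h1 : Continuous fun x : Em m => (2 * deriv θ (‖x - a‖ ^ 2)) • innerSL ℝ (x - a) := by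
      have := hθ.continuous_deriv
      fun_prop
    refine (hφs.continuous.continuousOn.smul hf'c).add ?_
    exact ((ContinuousLinearMap.smulRightL ℝ (Em m) ell2).continuous₂.comp_continuousOn
      (h1.continuousOn.prodMk hfc))
  have hG0 : ∀ x, x ∉ ball a R → G x = 0 := fun x hx => by
    have := hθ.deriv_eq_zero (IsRadialCutoff.sq_le_of_notMem_ball hR.le hx)
    ext v
    simp [hG, hφ0 x hx, this]
  have hfd : ∀ (t : ℝ), ∀ x ∈ U, hsNormSq (fderiv ℝ (fun z => f z + t • φ z • f z) x) =
      hsNormSq (f' x + t • G x) := by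
    intro t x hx
    congr 1
    exact ((hf x hx).add (((hasFDerivAt_comp_norm_sub_sq (hθ.hasDerivAt _)).smul
      (hf x hx)).const_smul t)).fderiv
  have hder' : HasDerivAt (fun t : ℝ => ∫ x in U, hsNormSq (f' x + t • G x)) 0 0 := by
    convert hder using 2 with t
    exact setIntegral_congr_fun hU.measurableSet fun x hx => (hfd t x hx).symm
  rw [← setIntegral_hsInner_eq_zero hU hf'c hfin hK hGc hG0 hder']
  refine setIntegral_congr_fun measurableSet_ball fun x _ => ?_
  exact (hsInner_smul_add_smulRight _ _ _ _ _).symm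

end outerVariation

/-- Integral over the unit sphere of `ω ↦ k (a + ρ ω) ω`, with `ρ` truncated to `[0, R]`. -/
def sphereIntegral {m : ℕ} (R : ℝ) (a : Em m) (k : Em m → Em m → ℝ) (ρ : ℝ) : ℝ :=
  ∫ ω, k (a + max 0 (min ρ R) • (ω : Em m)) ω ∂((volume : Measure (Em m)).toSphere)

section sphereIntegral

variable {m : ℕ} {a : Em m} {R : ℝ} {k : Em m → Em m → ℝ}

lemma clamp_mem_Icc (hR : 0 ≤ R) (ρ : ℝ) : max 0 (min ρ R) ∈ Set.Icc 0 R :=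
  ⟨le_max_left _ _, max_le hR (min_le_right _ _)⟩

lemma clamp_eq_self {ρ : ℝ} (hρ : ρ ∈ Set.Icc 0 R) : max 0 (min ρ R) = ρ := by
  rw [min_eq_left hρ.2, max_eq_right hρ.1]

lemma add_smul_mem_closedBall (a : Em m) {ρ : ℝ} (hρ : ρ ∈ Set.Icc 0 R)
    (ω : sphere (0 : Em m) 1) : a + ρ • (ω : Em m) ∈ closedBall a R := by
  simpa [norm_smul, abs_of_nonneg hρ.1] using hρ.2

lemma sphereIntegral_of_mem_Icc {ρ : ℝ} (hρ : ρ ∈ Set.Icc 0 R) : sphereIntegral R a k ρ =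
    ∫ ω, k (a + ρ • (ω : Em m)) ω ∂((volume : Measure (Em m)).toSphere) := by
  rw [sphereIntegral, clamp_eq_self hρ]

lemma continuousOn_sphere_kernel
    (hk : ContinuousOn (Function.uncurry k) (closedBall a R ×ˢ Set.univ)) :
    ContinuousOn (Function.uncurry fun (ρ : ℝ) (ω : sphere (0 : Em m) 1) =>
      k (a + ρ • (ω : Em m)) ω) (Set.Icc 0 R ×ˢ Set.univ) :=
  hk.comp (f := fun p : ℝ × sphere (0 : Em m) 1 => (a + p.1 • (p.2 : Em m), (p.2 : Em m)))
    (Continuous.continuousOn (by fun_prop))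
    fun p hp => ⟨add_smul_mem_closedBall a hp.1 p.2, Set.mem_univ _⟩

lemma continuous_sphereIntegral (hR : 0 ≤ R)
    (hk : ContinuousOn (Function.uncurry k) (closedBall a R ×ˢ Set.univ)) :
    Continuous (sphereIntegral R a k) :=
  (continuousOn_integral_sphere (μ := (volume : Measure (Em m)).toSphere) hR
    (continuousOn_sphere_kernel hk)).comp_continuous (by fun_prop) fun ρ => clamp_mem_Icc hR ρ

lemma continuous_sphere_kernel
    (hk : ContinuousOn (Function.uncurry k) (closedBall a R ×ˢ Set.univ)) {ρ : ℝ}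
    (hρ : ρ ∈ Set.Icc 0 R) :
    Continuous fun ω : sphere (0 : Em m) 1 => k (a + ρ • (ω : Em m)) ω :=
  (continuousOn_sphere_kernel hk).comp_continuous
    (f := fun ω : sphere (0 : Em m) 1 => (ρ, ω)) (by fun_prop) fun ω => ⟨hρ, Set.mem_univ _⟩

lemma integrable_sphere_kernel
    (hk : ContinuousOn (Function.uncurry k) (closedBall a R ×ˢ Set.univ)) {ρ : ℝ}
    (hρ : ρ ∈ Set.Icc 0 R) :
    Integrable (fun ω : sphere (0 : Em m) 1 => k (a + ρ • (ω : Em m)) ω)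
      (volume : Measure (Em m)).toSphere :=
  (continuous_sphere_kernel hk hρ).integrable_of_hasCompactSupport
    (HasCompactSupport.of_compactSpace _)

end sphereIntegral

section kernels

variable {m : ℕ} {a : Em m} {R : ℝ} {f : Em m → ell2} {f' : Em m → (Em m →L[ℝ] ell2)}

lemma continuousOn_kernel_hsNormSq (hf'c : ContinuousOn f' (closedBall a R)) :
    ContinuousOn (Function.uncurry fun (x : Em m) (_ : Em m) => hsNormSq (f' x))
      (closedBall a R ×ˢ Set.univ) :=
  continuous_hsNormSq.comp_continuousOn
    (hf'c.comp continuous_fst.continuousOn fun _ hp => hp.1)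

lemma continuousOn_kernel_apply (hf'c : ContinuousOn f' (closedBall a R)) :
    ContinuousOn (fun p : Em m × Em m => f' p.1 p.2) (closedBall a R ×ˢ Set.univ) :=
  (hf'c.comp continuous_fst.continuousOn fun _ hp => hp.1).clm_apply continuous_snd.continuousOn

lemma continuousOn_kernel_normSq (hf'c : ContinuousOn f' (closedBall a R)) :
    ContinuousOn (Function.uncurry fun (x w : Em m) => ‖f' x w‖ ^ 2)
      (closedBall a R ×ˢ Set.univ) :=
  (continuousOn_kernel_apply hf'c).norm.pow 2

lemma continuousOn_kernel_inner (hfc : ContinuousOn f (closedBall a R))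
    (hf'c : ContinuousOn f' (closedBall a R)) :
    ContinuousOn (Function.uncurry fun (x w : Em m) => ⟪f x, f' x w⟫)
      (closedBall a R ×ˢ Set.univ) :=
  ContinuousOn.inner (𝕜 := ℝ) (hfc.comp continuous_fst.continuousOn fun _ hp => hp.1)
    (continuousOn_kernel_apply hf'c)

lemma continuousOn_kernel_sq (hfc : ContinuousOn f (closedBall a R)) :
    ContinuousOn (Function.uncurry fun (x _ : Em m) => ‖f x‖ ^ 2)
      (closedBall a R ×ˢ Set.univ) :=
  (hfc.comp continuous_fst.continuousOn fun _ hp => hp.1).norm.pow 2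

/-- Cauchy–Schwarz on the sphere. -/
lemma sphereIntegral_inner_sq_le (hR : 0 ≤ R) (hfc : ContinuousOn f (closedBall a R))
    (hf'c : ContinuousOn f' (closedBall a R)) (ρ : ℝ) :
    sphereIntegral R a (fun x w => ⟪f x, f' x w⟫) ρ ^ 2 ≤
      sphereIntegral R a (fun x _ => ‖f x‖ ^ 2) ρ *
        sphereIntegral R a (fun x w => ‖f' x w‖ ^ 2) ρ := by
  have hρ := clamp_mem_Icc hR ρ
  have h1 := integrable_sphere_kernel (continuousOn_kernel_inner hfc hf'c) hρ
  have h2 := integrable_sphere_kernel (continuousOn_kernel_sq hfc) hρ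
  have h3 := integrable_sphere_kernel (continuousOn_kernel_normSq hf'c) hρ
  have hquad : ∀ s : ℝ, 0 ≤ sphereIntegral R a (fun x _ => ‖f x‖ ^ 2) ρ * (s * s) +
      2 * sphereIntegral R a (fun x w => ⟪f x, f' x w⟫) ρ * s +
        sphereIntegral R a (fun x w => ‖f' x w‖ ^ 2) ρ := by
    intro s
    unfold sphereIntegral
    rw [← integral_mul_const, ← integral_const_mul, ← integral_mul_const,
      ← integral_add (h2.mul_const _) ((h1.const_mul 2).mul_const s)]
    refine (integral_nonneg fun ω => ?_).trans_eq
      (integral_add ((h2.mul_const (s * s)).add ((h1.const_mul 2).mul_const s)) h3)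
    have := norm_add_sq_real (s • f (a + max 0 (min ρ R) • (ω : Em m)))
      (f' (a + max 0 (min ρ R) • (ω : Em m)) ω)
    rw [norm_smul, mul_pow, Real.norm_eq_abs, sq_abs, real_inner_smul_left] at this
    have h0 := sq_nonneg ‖s • f (a + max 0 (min ρ R) • (ω : Em m)) +
      f' (a + max 0 (min ρ R) • (ω : Em m)) ω‖
    simp only [Pi.zero_apply]
    linarith
  have := discrim_le_zero hquad
  rw [discrim] at this
  nlinarith

/-- Derivative of the spherical mean of `‖f‖²`. -/
lemma hasDerivAt_sphereIntegral_sq (hf : ∀ x ∈ closedBall a R, HasFDerivAt f (f' x) x)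
    (hf'c : ContinuousOn f' (closedBall a R)) {r : ℝ} (hr : r ∈ Set.Ioo 0 R) :
    HasDerivAt (sphereIntegral R a fun x _ => ‖f x‖ ^ 2)
      (2 * sphereIntegral R a (fun x w => ⟪f x, f' x w⟫) r) r := by
  have hfc : ContinuousOn f (closedBall a R) := fun x hx => (hf x hx).continuousAt.continuousWithinAt
  have hsub : Set.Ioo 0 R ⊆ Set.Icc 0 R := Set.Ioo_subset_Icc_self
  have hk := continuousOn_kernel_inner hfc hf'c
  have hk2 := continuousOn_kernel_sq hfc
  obtain ⟨C, hC⟩ := (isCompact_Icc.prod isCompact_univ).exists_bound_of_continuousOn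
    (continuousOn_sphere_kernel hk)
  have hnhds : Set.Ioo 0 R ∈ 𝓝 r := isOpen_Ioo.mem_nhds hr
  have key := (hasDerivAt_integral_of_dominated_loc_of_deriv_le
    (μ := (volume : Measure (Em m)).toSphere)
    (F := fun (ρ : ℝ) (ω : sphere (0 : Em m) 1) => ‖f (a + ρ • (ω : Em m))‖ ^ 2)
    (F' := fun (ρ : ℝ) (ω : sphere (0 : Em m) 1) =>
      2 * ⟪f (a + ρ • (ω : Em m)), f' (a + ρ • (ω : Em m)) ω⟫)
    (bound := fun _ => 2 * C) hnhds
    (by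
      filter_upwards [hnhds] with ρ hρ
      exact (integrable_sphere_kernel hk2 (hsub hρ)).aestronglyMeasurable)
    (integrable_sphere_kernel hk2 (hsub hr))
    ((integrable_sphere_kernel hk (hsub hr)).const_mul 2).aestronglyMeasurable
    (by
      refine Filter.Eventually.of_forall fun ω ρ hρ => ?_
      rw [norm_mul, Real.norm_two]
      exact mul_le_mul_of_nonneg_left (hC (ρ, ω) ⟨hsub hρ, Set.mem_univ _⟩) zero_le_two)
    (integrable_const _)
    (by
      refine Filter.Eventually.of_forall fun ω ρ hρ => ?_
      have hline : HasDerivAt (fun ρ : ℝ => a + ρ • (ω : Em m)) (ω : Em m) ρ := by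
        simpa using ((hasDerivAt_id ρ).smul_const (ω : Em m)).const_add a
      exact ((hf _ (add_smul_mem_closedBall a (hsub hρ) ω)).comp_hasDerivAt ρ hline).norm_sq)).2
  rw [integral_const_mul, ← sphereIntegral_of_mem_Icc (k := fun x w => ⟪f x, f' x w⟫)
    (hsub hr)] at key
  refine key.congr_of_eventuallyEq ?_
  filter_upwards [hnhds] with ρ hρ
  exact sphereIntegral_of_mem_Icc (hsub hρ)

/-- The energy of a ball in polar coordinates. -/
lemma setIntegral_ball_hsNormSq (hm : 1 ≤ m) (hf'c : ContinuousOn f' (closedBall a R)) {r : ℝ}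
    (hr : r ∈ Set.Icc 0 R) : ∫ x in ball a r, hsNormSq (f' x) =
      ∫ ρ in (0 : ℝ)..r, ρ ^ (m - 1) * sphereIntegral R a (fun x _ => hsNormSq (f' x)) ρ := by
  rw [setIntegral_ball_eq_intervalIntegral (g := fun x => hsNormSq (f' x)) hm a hr.1
    (((continuous_hsNormSq.comp_continuousOn hf'c).integrableOn_compact
      (isCompact_closedBall a R)).mono_set
        ((ball_subset_ball hr.2).trans ball_subset_closedBall))]
  refine intervalIntegral.integral_congr fun ρ hρ => ?_
  rw [Set.uIcc_of_le hr.1] at hρ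
  rw [sphereIntegral_of_mem_Icc ⟨hρ.1, hρ.2.trans hr.2⟩]

end kernels

lemma hsNormSq_comp_smul_id_add {m : ℕ} (B : Em m →L[ℝ] ell2) (α β : ℝ) (w : Em m) :
    hsNormSq (B.comp (α • ContinuousLinearMap.id ℝ (Em m) + (β • innerSL ℝ w).smulRight w)) =
      α ^ 2 * hsNormSq B + (2 * α * β + β ^ 2 * ‖w‖ ^ 2) * ‖B w‖ ^ 2 := by
  have hw : ‖B w‖ ^ 2 = ∑ i, w i * ⟪B (EuclideanSpace.single i 1), B w⟫ := by
    have h := congrArg (fun v => ⟪B v, B w⟫) (sum_smul_single w)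
    simp only [map_sum, sum_inner, map_smul, real_inner_smul_left] at h
    rw [h, real_inner_self_eq_norm_sq]
  have hn : ‖w‖ ^ 2 = ∑ i, w i ^ 2 := EuclideanSpace.real_norm_sq_eq w
  have hsum : hsNormSq (B.comp (α • ContinuousLinearMap.id ℝ (Em m) +
      (β • innerSL ℝ w).smulRight w)) = α ^ 2 * hsNormSq B +
        2 * α * β * (∑ i, w i * ⟪B (EuclideanSpace.single i 1), B w⟫) +
          β ^ 2 * (∑ i, w i ^ 2) * ‖B w‖ ^ 2 := by
    simp only [hsNormSq, Finset.mul_sum, Finset.sum_mul, ← Finset.sum_add_distrib]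
    refine Finset.sum_congr rfl fun i _ => ?_
    have : B.comp (α • ContinuousLinearMap.id ℝ (Em m) + (β • innerSL ℝ w).smulRight w)
        (EuclideanSpace.single i 1) =
          α • B (EuclideanSpace.single i 1) + (β * w i) • B w := by
      simp [EuclideanSpace.inner_single_right]
    rw [this, norm_add_sq_real, norm_smul, norm_smul, real_inner_smul_left,
      real_inner_smul_right, mul_pow, mul_pow, Real.norm_eq_abs, Real.norm_eq_abs, sq_abs, sq_abs]
    ring
  rw [hsum, ← hw, ← hn]
  ring

section stationary

variable {n : ℕ} {U : Set (Em (n + 2))} {f : Em (n + 2) → ell2}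
  {f' : Em (n + 2) → (Em (n + 2) →L[ℝ] ell2)} {a : Em (n + 2)} {R : ℝ}

/-- The outer variation formula in polar coordinates. -/
lemma SquashStationary.integral_cutoff_eq_zero (hU : IsOpen U)
    (hf : ∀ x ∈ U, HasFDerivAt f (f' x) x) (hf'c : ContinuousOn f' U)
    (hfin : IntegrableOn (fun x => hsNormSq (f' x)) U volume)
    (hsquash : SquashStationary U f) (hK : closedBall a R ⊆ U) {θ : ℝ → ℝ}
    (hθ : IsRadialCutoff R θ) :
    ∫ ρ in (0 : ℝ)..R, ρ ^ (n + 1) *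
      (θ (ρ ^ 2) * sphereIntegral R a (fun x _ => hsNormSq (f' x)) ρ +
        2 * ρ * deriv θ (ρ ^ 2) * sphereIntegral R a (fun x w => ⟪f x, f' x w⟫) ρ) = 0 := by
  have hfc : ContinuousOn f (closedBall a R) := fun x hx =>
    (hf x (hK hx)).continuousAt.continuousWithinAt
  have hf'cK := hf'c.mono hK
  have hcont : ContinuousOn (fun x => θ (‖x - a‖ ^ 2) * hsNormSq (f' x) +
      2 * deriv θ (‖x - a‖ ^ 2) * ⟪f x, f' x (x - a)⟫) (closedBall a R) := by
    have h1 := continuous_hsNormSq.comp_continuousOn hf'cK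
    have h2 := (hθ.contDiff_comp_norm a).continuous
    have h3 : Continuous fun x : Em (n + 2) => 2 * deriv θ (‖x - a‖ ^ 2) := by
      have := hθ.continuous_deriv
      fun_prop
    exact (h2.continuousOn.mul h1).add (h3.continuousOn.mul (ContinuousOn.inner (𝕜 := ℝ) hfc
      (hf'cK.clm_apply (by fun_prop))))
  refine Eq.trans ?_ (hsquash.integral_radial_eq_zero hU hf hf'c hfin hK hθ)
  rw [setIntegral_ball_eq_intervalIntegral (by omega) a hθ.pos.le
      ((hcont.integrableOn_compact (isCompact_closedBall a R)).mono_set ball_subset_closedBall)]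
  refine intervalIntegral.integral_congr fun ρ hρ => ?_
  rw [Set.uIcc_of_le hθ.pos.le] at hρ
  have hi1 := integrable_sphere_kernel (continuousOn_kernel_hsNormSq hf'cK) hρ
  have hi2 := integrable_sphere_kernel (continuousOn_kernel_inner hfc hf'cK) hρ
  simp only [sphereIntegral_of_mem_Icc hρ]
  congr 1
  rw [← integral_const_mul, ← integral_const_mul,
    ← integral_add (hi1.const_mul _) (hi2.const_mul _)]
  refine integral_congr_ae (Filter.Eventually.of_forall fun ω => ?_)
  have hω : ‖(ω : Em (n + 2))‖ = 1 := mem_sphere_zero_iff_norm.1 ω.2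
  simp only [add_sub_cancel_left, norm_smul, hω, mul_one, Real.norm_eq_abs, sq_abs, map_smul,
    real_inner_smul_right]
  ring

/-- The derivative of the energy under an inner variation along a radial field. -/
lemma SqueezeStationary.integral_cutoff_eq_zero (hU : IsOpen U)
    (hf : ∀ x ∈ U, HasFDerivAt f (f' x) x) (hf'c : ContinuousOn f' U)
    (hfin : IntegrableOn (fun x => hsNormSq (f' x)) U volume)
    (hsqueeze : SqueezeStationary U f) (hK : closedBall a R ⊆ U) {θ : ℝ → ℝ}
    (hθ : IsRadialCutoff R θ) :
    ∫ ρ in (0 : ℝ)..R, ρ ^ (n + 1) *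
      ((-(n * θ (ρ ^ 2)) - ρ * (2 * ρ * deriv θ (ρ ^ 2))) *
          sphereIntegral R a (fun x _ => hsNormSq (f' x)) ρ +
        2 * (ρ * (2 * ρ * deriv θ (ρ ^ 2))) *
          sphereIntegral R a (fun x w => ‖f' x w‖ ^ 2) ρ) = 0 := by
  have hR := hθ.pos
  have hf'cK := hf'c.mono hK
  have hθc := hθ.contDiff.continuous
  have hθ'c := hθ.continuous_deriv
  set φ : Em (n + 2) → ℝ := fun x => θ (‖x - a‖ ^ 2) with hφ
  have hφs : ContDiff ℝ (⊤ : ℕ∞) φ := hθ.contDiff_comp_norm a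
  have hφ0 : ∀ x, x ∉ ball a R → φ x = 0 := fun x hx =>
    hθ.eq_zero (IsRadialCutoff.sq_le_of_notMem_ball hR.le hx)
  have hsupp : tsupport (fun x => φ x • (x - a)) ⊆ closedBall a R := by
    refine closure_minimal (fun x hx => ?_) isClosed_closedBall
    by_contra hx'
    exact hx (by simp [hφ0 x fun h => hx' (ball_subset_closedBall h)])
  have hder := hsqueeze (fun x => φ x • (x - a)) (hφs.smul (contDiff_id.sub contDiff_const))
    ((isCompact_closedBall a R).of_isClosed_subset (isClosed_tsupport _) hsupp)
    (hsupp.trans hK)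
  set Φ : ℝ → Em (n + 2) → Em (n + 2) := fun t x => x + t • φ x • (x - a) with hΦ
  have hΦc : ∀ t, Continuous (Φ t) := fun t => by
    have := hφs.continuous
    fun_prop
  have hΦd : ∀ t x, HasFDerivAt (Φ t) ((1 + t * φ x) • ContinuousLinearMap.id ℝ _ +
      ((t * (2 * deriv θ (‖x - a‖ ^ 2))) • innerSL ℝ (x - a)).smulRight (x - a)) x := by
    intro t x
    refine ((hasFDerivAt_id x).add (((hasFDerivAt_comp_norm_sub_sq (hθ.hasDerivAt _)).smul
      ((hasFDerivAt_id x).sub_const a)).const_smul t)).congr_fderiv ?_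
    ext1 v
    simp only [hφ, add_apply, smul_apply, ContinuousLinearMap.smulRight_apply,
      ContinuousLinearMap.id_apply, id, smul_eq_mul]
    module
  obtain ⟨r₁, hr₁, hr₁R, hvan⟩ := hθ.vanish
  have hmaps : ∀ᶠ t : ℝ in 𝓝 0, ∀ ρ ∈ Set.Icc 0 R, ρ * (1 + t * θ (ρ ^ 2)) ∈ Set.Icc 0 R := by
    have hsmall : ∀ᶠ t : ℝ in 𝓝 0, |t| < min 1 ((R - r₁) / r₁) := by
      have : Filter.Tendsto (fun t : ℝ => |t|) (𝓝 0) (𝓝 0) := by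
        simpa using (continuous_abs.tendsto (0 : ℝ))
      exact this.eventually_lt_const (lt_min one_pos (div_pos (by linarith) hr₁))
    filter_upwards [hsmall] with t ht ρ hρ
    obtain ⟨ht1, ht2⟩ := lt_min_iff.1 ht
    rw [lt_div_iff₀ hr₁] at ht2
    have habs : |t * θ (ρ ^ 2)| ≤ |t| := by
      rw [abs_mul, abs_of_nonneg (hθ.nonneg _)]
      exact mul_le_of_le_one_right (abs_nonneg _) (hθ.le_one _)
    have hab := abs_le.1 habs
    refine ⟨mul_nonneg hρ.1 (by linarith [hab.1]), ?_⟩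
    rcases le_or_gt r₁ ρ with h | h
    · rw [hvan _ (pow_le_pow_left₀ hr₁.le h 2)]
      simpa using hρ.2
    · have h1 : ρ * (1 + t * θ (ρ ^ 2)) ≤ r₁ * (1 + |t|) :=
        mul_le_mul h.le (by linarith [hab.2]) (by linarith [hab.1]) hr₁.le
      linarith
  have hpolar : ∀ t ρ, 0 ≤ ρ → ∀ ω : sphere (0 : Em (n + 2)) 1,
      Φ t (a + ρ • (ω : Em (n + 2))) = a + (ρ * (1 + t * θ (ρ ^ 2))) • (ω : Em (n + 2)) := by
    intro t ρ hρ ω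
    have hω : ‖(ω : Em (n + 2))‖ = 1 := mem_sphere_zero_iff_norm.1 ω.2
    simp only [hΦ, hφ, add_sub_cancel_left, norm_smul, hω, mul_one, Real.norm_eq_abs, sq_abs]
    module
  set W : ℝ → Em (n + 2) → ℝ := fun t x => (1 + t * φ x) ^ 2 * hsNormSq (f' (Φ t x)) +
    (2 * (1 + t * φ x) * (t * (2 * deriv θ (‖x - a‖ ^ 2))) +
      (t * (2 * deriv θ (‖x - a‖ ^ 2))) ^ 2 * ‖x - a‖ ^ 2) * ‖f' (Φ t x) (x - a)‖ ^ 2 with hW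
  have hUeq : ∀ᶠ t : ℝ in 𝓝 0, ∫ x in U, hsNormSq (fderiv ℝ (fun y => f (Φ t y)) x) =
      (∫ x in U \ ball a R, hsNormSq (f' x)) + ∫ ρ in (0 : ℝ)..R, ρ ^ (n + 1) *
        ((1 + t * θ (ρ ^ 2)) ^ 2 *
            sphereIntegral R a (fun x _ => hsNormSq (f' x)) (ρ * (1 + t * θ (ρ ^ 2))) +
          ((1 + t * θ (ρ ^ 2) + t * (ρ * (2 * ρ * deriv θ (ρ ^ 2)))) ^ 2 -
            (1 + t * θ (ρ ^ 2)) ^ 2) *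
              sphereIntegral R a (fun x w => ‖f' x w‖ ^ 2) (ρ * (1 + t * θ (ρ ^ 2)))) := by
    filter_upwards [hmaps] with t ht
    have hball : ∀ x ∈ closedBall a R, Φ t x ∈ closedBall a R := by
      intro x hx
      have hρ := ht ‖x - a‖ ⟨norm_nonneg _, mem_closedBall_iff_norm.1 hx⟩
      have : Φ t x - a = (1 + t * θ (‖x - a‖ ^ 2)) • (x - a) := by
        simp only [hΦ, hφ]
        module
      rw [mem_closedBall_iff_norm, this, norm_smul, ← abs_norm (x - a), Real.norm_eq_abs,
        ← abs_mul, abs_norm, mul_comm, abs_of_nonneg hρ.1]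
      exact hρ.2
    have hfd : ∀ x, Φ t x ∈ U → hsNormSq (fderiv ℝ (fun y => f (Φ t y)) x) = W t x := by
      intro x hx
      have : HasFDerivAt (fun y => f (Φ t y)) _ x := (hf _ hx).comp x (hΦd t x)
      rw [this.fderiv, hsNormSq_comp_smul_id_add]
    have hout : ∀ x ∈ U \ ball a R,
        hsNormSq (fderiv ℝ (fun y => f (Φ t y)) x) = hsNormSq (f' x) := by
      intro x hx
      have h0 : φ x = 0 := hφ0 x hx.2
      have h1 : deriv θ (‖x - a‖ ^ 2) = 0 :=
        hθ.deriv_eq_zero (IsRadialCutoff.sq_le_of_notMem_ball hR.le hx.2)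
      have h2 : Φ t x = x := by simp [hΦ, h0]
      rw [hfd x (by rw [h2]; exact hx.1)]
      simp [hW, h0, h1, h2]
    have hin : ∀ x ∈ ball a R, hsNormSq (fderiv ℝ (fun y => f (Φ t y)) x) = W t x :=
      fun x hx => hfd x (hK (hball x (ball_subset_closedBall hx)))
    have hWc : ContinuousOn (W t) (closedBall a R) := by
      have h1 : ContinuousOn (fun x => f' (Φ t x)) (closedBall a R) :=
        hf'cK.comp (hΦc t).continuousOn hball
      have h2 := continuous_hsNormSq.comp_continuousOn h1
      have h3 : ContinuousOn (fun x => f' (Φ t x) (x - a)) (closedBall a R) :=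
        h1.clm_apply (by fun_prop)
      have h4 := hφs.continuous
      refine ContinuousOn.add (ContinuousOn.mul (by fun_prop) h2)
        (ContinuousOn.mul (by fun_prop) (h3.norm.pow 2))
    have hWi : IntegrableOn (W t) (ball a R) :=
      (hWc.integrableOn_compact (isCompact_closedBall a R)).mono_set ball_subset_closedBall
    have hmeas : MeasurableSet (U \ ball a R) := hU.measurableSet.diff measurableSet_ball
    have hsplit := setIntegral_union (μ := (volume : Measure (Em (n + 2))))
      (f := fun x => hsNormSq (fderiv ℝ (fun y => f (Φ t y)) x))
      (s := U \ ball a R) (t := ball a R) Set.disjoint_sdiff_left measurableSet_ball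
      ((hfin.mono_set Set.sdiff_subset).congr_fun (fun x hx => (hout x hx).symm) hmeas)
      (hWi.congr_fun (fun x hx => (hin x hx).symm) measurableSet_ball)
    rw [Set.sdiff_union_of_subset (ball_subset_closedBall.trans hK)] at hsplit
    rw [hsplit, setIntegral_congr_fun hmeas hout, setIntegral_congr_fun measurableSet_ball hin,
      setIntegral_ball_eq_intervalIntegral (by omega) a hR.le hWi]
    congr 1
    refine intervalIntegral.integral_congr fun ρ hρ => ?_
    rw [Set.uIcc_of_le hR.le] at hρ
    have hi1 := integrable_sphere_kernel (continuousOn_kernel_hsNormSq hf'cK) (ht ρ hρ)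
    have hi2 := integrable_sphere_kernel (continuousOn_kernel_normSq hf'cK) (ht ρ hρ)
    simp only [sphereIntegral_of_mem_Icc (ht ρ hρ)]
    congr 1
    rw [← integral_const_mul, ← integral_const_mul,
      ← integral_add (hi1.const_mul _) (hi2.const_mul _)]
    refine integral_congr_ae (Filter.Eventually.of_forall fun ω => ?_)
    have hω : ‖(ω : Em (n + 2))‖ = 1 := mem_sphere_zero_iff_norm.1 ω.2
    simp only [hW, hpolar t ρ hρ.1 ω, hφ, add_sub_cancel_left, norm_smul, hω, mul_one,
      Real.norm_eq_abs, sq_abs, map_smul, mul_pow]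
    ring
  have hradial := hasDerivAt_radial_energy (R := R) (n := n)
    (continuous_sphereIntegral hR.le (continuousOn_kernel_hsNormSq hf'cK))
    (continuous_sphereIntegral hR.le (continuousOn_kernel_normSq hf'cK))
    (fun ρ => hθ.hasDerivAt_comp_sq ρ) (by fun_prop) hθ.apply_radius_sq
  exact ((hradial.const_add _).congr_of_eventuallyEq hUeq).unique hder

end stationary

/-- Energy decay for squeeze and squash stationary maps:
for `r ∈ (0,r₀]`, `D_a(r)/r^{m−2} ≤ (r/r₀)^{2N_a(r)}·(D_a(r₀)/r₀^{m−2})·(N_a(r)/N_a(r₀))`. -/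
theorem stmt14 (m : ℕ) (hm : 2 ≤ m) (U : Set (Em m)) (hU : IsOpen U)
    (f : Em m → ell2) (f' : Em m → (Em m →L[ℝ] ell2))
    (hf : ∀ x ∈ U, HasFDerivAt f (f' x) x) (hf'c : ContinuousOn f' U)
    (hfin : IntegrableOn (fun x => hsNormSq (f' x)) U volume)
    (hsqueeze : SqueezeStationary U f) (hsquash : SquashStationary U f)
    (a : Em m) (ha : a ∈ U)
    (r₀ : ℝ) (hr₀ : 0 < r₀) (hr₀U : r₀ < Metric.infDist a Uᶜ)
    (hH : ∀ ρ ∈ Set.Ioc (0 : ℝ) r₀,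
      0 < ∫ x in Metric.sphere a ρ, ‖f x‖ ^ 2 ∂(μH[((m : ℝ) - 1)]))
    (hD : 0 < ∫ x in Metric.ball a r₀, hsNormSq (f' x)) :
    ∀ r ∈ Set.Ioc (0 : ℝ) r₀,
      (∫ x in Metric.ball a r, hsNormSq (f' x)) / r ^ (m - 2)
        ≤ (r / r₀) ^ (2 * (r * (∫ x in Metric.ball a r, hsNormSq (f' x)) /
              ∫ x in Metric.sphere a r, ‖f x‖ ^ 2 ∂(μH[((m : ℝ) - 1)]))) *
          ((∫ x in Metric.ball a r₀, hsNormSq (f' x)) / r₀ ^ (m - 2)) *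
          ((r * (∫ x in Metric.ball a r, hsNormSq (f' x)) /
              ∫ x in Metric.sphere a r, ‖f x‖ ^ 2 ∂(μH[((m : ℝ) - 1)])) /
            (r₀ * (∫ x in Metric.ball a r₀, hsNormSq (f' x)) /
              ∫ x in Metric.sphere a r₀, ‖f x‖ ^ 2 ∂(μH[((m : ℝ) - 1)]))) := by
  obtain ⟨n, rfl⟩ : ∃ n, m = n + 2 := ⟨m - 2, by omega⟩
  intro r hr
  obtain ⟨R, hr₀R, hRU⟩ := exists_between hr₀U
  have hR : 0 < R := hr₀.trans hr₀R
  have hK : closedBall a R ⊆ U :=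
    (closedBall_subset_ball hRU).trans ball_infDist_compl_subset
  have hf'cK := hf'c.mono hK
  have hfc : ContinuousOn f (closedBall a R) := fun x hx =>
    (hf x (hK hx)).continuousAt.continuousWithinAt
  set A := sphereIntegral R a (fun x _ => hsNormSq (f' x))
  set B := sphereIntegral R a (fun x w => ‖f' x w‖ ^ 2)
  set E := sphereIntegral R a (fun x w => ⟪f x, f' x w⟫)
  set h := sphereIntegral R a (fun x _ => ‖f x‖ ^ 2) with hh
  have hA : Continuous A := continuous_sphereIntegral hR.le (continuousOn_kernel_hsNormSq hf'cK)
  have hB : Continuous B := continuous_sphereIntegral hR.le (continuousOn_kernel_normSq hf'cK)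
  have hE : Continuous E := continuous_sphereIntegral hR.le (continuousOn_kernel_inner hfc hf'cK)
  have hIoo : ∀ ρ ∈ Set.Ioc 0 r₀, ρ ∈ Set.Ioo 0 R := fun ρ hρ => ⟨hρ.1, hρ.2.trans_lt hr₀R⟩
  have hIcc : ∀ ρ ∈ Set.Ioc 0 r₀, ρ ∈ Set.Icc 0 R := fun ρ hρ =>
    Set.Ioo_subset_Icc_self (hIoo ρ hρ)
  have hr₀mem : r₀ ∈ Set.Ioc 0 r₀ := ⟨hr₀, le_rfl⟩
  have hball : ∀ ρ ∈ Set.Ioc 0 r₀, ∫ x in ball a ρ, hsNormSq (f' x) =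
      ∫ s in (0 : ℝ)..ρ, s ^ (n + 1) * A s := fun ρ hρ =>
    setIntegral_ball_hsNormSq (by omega) hf'cK (hIcc ρ hρ)
  obtain ⟨C, hC, hCH⟩ := exists_const_setIntegral_sphere (by omega) a hr₀
    (g := fun x => ‖f x‖ ^ 2) ((hfc.mono (closedBall_subset_closedBall hr₀R.le)).norm.pow 2)
    (hH r₀ hr₀mem).ne'
  have hCh : ∀ ρ ∈ Set.Ioc 0 r₀, ∫ x in sphere a ρ, ‖f x‖ ^ 2 ∂(μH[((n + 2 : ℕ) : ℝ) - 1]) =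
      C * (ρ ^ (n + 1) * h ρ) := fun ρ hρ => by
    rw [hCH ρ hρ, hh, sphereIntegral_of_mem_Icc (hIcc ρ hρ)]
    rfl
  have hpos : ∀ ρ ∈ Set.Ioc 0 r₀, 0 < h ρ := fun ρ hρ => by
    have h1 := hH ρ hρ
    rw [hCh ρ hρ] at h1
    exact pos_of_mul_pos_right (pos_of_mul_pos_right h1 (by linarith)) (pow_pos hρ.1 _).le
  have hderiv : ∀ ρ ∈ Set.Ioc 0 r₀, HasDerivAt h (2 * E ρ) ρ := fun ρ hρ =>
    hasDerivAt_sphereIntegral_sq (fun x hx => hf x (hK hx)) hf'cK (hIoo ρ hρ)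
  have hflux : ∀ ρ ∈ Set.Ioc 0 r₀, ρ ^ (n + 1) * E ρ = ∫ s in (0 : ℝ)..ρ, s ^ (n + 1) * A s :=
    fun ρ hρ => boundary_term_eq_energy hA hE
      (fun θ hθ => hsquash.integral_cutoff_eq_zero hU hf hf'c hfin hK hθ) hρ.1 (hIoo ρ hρ).2
  have hmono := monotoneOn_frequency (n := n) (D := fun ρ => ∫ s in (0 : ℝ)..ρ, s ^ (n + 1) * A s)
    hderiv
    (fun ρ _ => (((continuous_pow (n + 1)).mul hA).integral_hasStrictDerivAt 0 ρ).hasDerivAt)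
    hflux
    (fun ρ hρ => sphere_energy_eq hA hB
      (fun θ hθ => hsqueeze.integral_cutoff_eq_zero hU hf hf'c hfin hK hθ) hρ.1 (hIoo ρ hρ).2)
    (fun ρ _ => sphereIntegral_inner_sq_le hR.le hfc hf'cK ρ) hpos
  have hmean := spherical_mean_le hderiv hflux hpos hmono hr
  simp only [← hball r hr] at hmean
  exact energy_decay_of_spherical_mean_le (D := fun ρ => ∫ x in ball a ρ, hsNormSq (f' x))
    (H := fun ρ => ∫ x in sphere a ρ, ‖f x‖ ^ 2 ∂(μH[((n + 2 : ℕ) : ℝ) - 1]))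
    hr.1 hr.2 hC hCh hpos (integral_nonneg fun x => hsNormSq_nonneg _) hD hmean
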